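/- arXiv:1803.09483 — 2 statements merged into one kernel-verified Lean document; each statement's English description precedes it below -/
import Mathlib

section
/- Let (H,x) be a properly r-boundaried weighted graph and let p be a positive integer. Then there exists a properly r-boundaried weighted graph (H',x') with at most 2^{2^{r−1}} + r vertices such that for every r-boundaried weighted graph (F,y), every positive integer t, and all positive integers λ_1,…,λ_t ≤ p: the graph (F,y)⊕_b(H,x) has exactly t connected components whose weighted connectivities are λ_1,…,λ_t respectively if and only if (F,y)⊕_b(H',x') has exactly t connected components whose weighted connectivities are λ_1,…,λ_t respectively. -/
open scoped Classical

/-- The weighted connectivity of `(G,w)`: the largest `k ∈ ℕ∞` such that deleting any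
edge set of total weight at most `k - 1` leaves `G` connected (`+∞` for a one-vertex
graph). -/
noncomputable def weightConn {V : Type*} [Fintype V] (G : SimpleGraph V) (w : Sym2 V → ℕ) :
    ℕ∞ :=
  sSup {k : ℕ∞ | ∀ S : Finset (Sym2 V), ↑S ⊆ G.edgeSet →
    (∑ e ∈ S, (w e : ℕ∞)) < k → (G.deleteEdges ↑S).Connected}

/-- The weighted connectivity of the subgraph of `(G,w)` induced by the vertex set `C`. -/
noncomputable def compConn {V : Type*} [Fintype V] (G : SimpleGraph V) (w : Sym2 V → ℕ)
    (C : Set V) : ℕ∞ :=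
  weightConn (G.induce C) (fun e => w (Sym2.map Subtype.val e))

/-- The multiset of the weighted connectivities of the connected components of `(G,w)`. -/
noncomputable def connMultiset {V : Type*} [Fintype V] (G : SimpleGraph V)
    (w : Sym2 V → ℕ) : Multiset ℕ∞ :=
  (@Finset.univ G.ConnectedComponent (Fintype.ofFinite _)).val.map
    (fun c => compConn G w c.supp)

/-- `(H,x)` is a properly `r`-boundaried graph: the boundary vertices are pairwise
nonadjacent and every connected component of `H` contains a boundary vertex. -/
def ProperB {VH : Type*} {r : ℕ} (H : SimpleGraph VH) (x : Fin r ↪ VH) : Prop :=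
  (∀ i j, ¬ H.Adj (x i) (x j)) ∧ ∀ v : VH, ∃ i, H.Reachable v (x i)

/-- The boundary sum `(F,y) ⊕_b (H,x)`: disjoint copies of `F` and `H` with the `i`-th
boundary vertex of `H` identified with the `i`-th boundary vertex of `F`. -/
def BSum {VF VH : Type*} {r : ℕ} (F : SimpleGraph VF) (y : Fin r → VF)
    (H : SimpleGraph VH) (x : Fin r → VH) :
    SimpleGraph (VF ⊕ {v : VH // v ∉ Set.range x}) :=
  SimpleGraph.fromRel fun a b =>
    match a, b with
    | Sum.inl a, Sum.inl b => F.Adj a b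
    | Sum.inr a, Sum.inr b => H.Adj a.1 b.1
    | Sum.inl a, Sum.inr b => ∃ i, y i = a ∧ H.Adj (x i) b.1
    | Sum.inr _, Sum.inl _ => False

/-- Auxiliary (ordered) weight function for the boundary sum. -/
noncomputable def bw {VF VH : Type*} {r : ℕ} (wF : Sym2 VF → ℕ) (wH : Sym2 VH → ℕ)
    (y : Fin r → VF) (x : Fin r → VH) :
    (VF ⊕ {v : VH // v ∉ Set.range x}) → (VF ⊕ {v : VH // v ∉ Set.range x}) → ℕ
  | Sum.inl a, Sum.inl b => wF s(a, b)
  | Sum.inr a, Sum.inr b => wH s(a.1, b.1)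
  | Sum.inl a, Sum.inr b => ∑ i : Fin r, if y i = a then wH s(x i, b.1) else 0
  | Sum.inr a, Sum.inl b => ∑ i : Fin r, if y i = b then wH s(x i, a.1) else 0

/-- The edge weights of the boundary sum `(F,y) ⊕_b (H,x)`, inherited from `wF` and
`wH`. -/
noncomputable def BSumW {VF VH : Type*} {r : ℕ} (wF : Sym2 VF → ℕ) (wH : Sym2 VH → ℕ)
    (y : Fin r → VF) (x : Fin r → VH) :
    Sym2 (VF ⊕ {v : VH // v ∉ Set.range x}) → ℕ :=
  Sym2.lift ⟨bw wF wH y x, by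
    intro u v
    cases u <;> cases v <;> simp only [bw] <;> first | rfl | rw [Sym2.eq_swap]⟩

/-! ### Cut functions of matrices -/

/-- The total weight that a matrix `m` sends from `Y` to its complement. -/
noncomputable def matCut {V : Type*} [Fintype V] (m : V → V → ℕ) (Y : Set V) : ℕ :=
  ∑ p : V × V, if p.1 ∈ Y ∧ p.2 ∉ Y then m p.1 p.2 else 0

/-- The pushforward of a matrix along a map of its index set. -/
noncomputable def matPush {U V : Type*} [Fintype U] (φ : U → V) (m : U → U → ℕ) (a b : V) : ℕ :=
  ∑ p : U × U, if φ p.1 = a ∧ φ p.2 = b then m p.1 p.2 else 0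

lemma matCut_congr {V : Type*} [Fintype V] {m m' : V → V → ℕ} {Y : Set V}
    (h : ∀ a b, a ≠ b → m a b = m' a b) : matCut m Y = matCut m' Y := by
  refine Finset.sum_congr rfl fun p _ => ?_
  split_ifs with hp
  · exact h _ _ fun e => hp.2 (e ▸ hp.1)
  · rfl

lemma matCut_add {V : Type*} [Fintype V] (m m' : V → V → ℕ) (Y : Set V) :
    matCut (fun a b => m a b + m' a b) Y = matCut m Y + matCut m' Y := by
  simp only [matCut, ← Finset.sum_add_distrib]
  refine Finset.sum_congr rfl fun p _ => ?_
  split_ifs <;> rfl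

lemma matCut_push {U V : Type*} [Fintype U] [Fintype V] (φ : U → V) (m : U → U → ℕ)
    (Y : Set V) : matCut (matPush φ m) Y = matCut m (φ ⁻¹' Y) := by
  have h : ∀ q : V × V, (if q.1 ∈ Y ∧ q.2 ∉ Y then matPush φ m q.1 q.2 else 0) =
      ∑ p : U × U, if (φ p.1, φ p.2) = q then
        (if p.1 ∈ φ ⁻¹' Y ∧ p.2 ∉ φ ⁻¹' Y then m p.1 p.2 else 0) else 0 := by
    rintro ⟨a, b⟩
    by_cases hq : a ∈ Y ∧ b ∉ Y
    · rw [if_pos hq]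
      refine Finset.sum_congr rfl fun p _ => ?_
      simp only [Prod.mk.injEq]
      split_ifs with h1 h2
      · rfl
      · obtain ⟨rfl, rfl⟩ := h1
        exact absurd hq h2
      · rfl
    · rw [if_neg hq]
      refine (Finset.sum_eq_zero fun p _ => ?_).symm
      simp only [Prod.mk.injEq]
      split_ifs with h1 h2
      · obtain ⟨rfl, rfl⟩ := h1
        exact absurd h2 hq
      · rfl
      · rfl
  unfold matCut
  rw [Finset.sum_congr rfl fun q _ => h q, Finset.sum_comm]
  exact Finset.sum_congr rfl fun p _ => by simp

lemma matPush_apply {U V : Type*} [Fintype U] {φ : U → V} (hφ : φ.Injective)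
    (m : U → U → ℕ) (u v : U) : matPush φ m (φ u) (φ v) = m u v := by
  unfold matPush
  rw [Finset.sum_eq_single (u, v)]
  · simp
  · rintro ⟨a, b⟩ _ hne
    refine if_neg fun h => hne ?_
    exact Prod.ext (hφ h.1) (hφ h.2)
  · simp

lemma matPush_eq_zero {U V : Type*} [Fintype U] {φ : U → V} {m : U → U → ℕ} {a b : V}
    (h : ∀ u v, φ u = a → φ v = b → m u v = 0) : matPush φ m a b = 0 :=
  Finset.sum_eq_zero fun p _ => by
    split_ifs with hp
    · exact h _ _ hp.1 hp.2
    · rfl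

lemma matPush_symm {U V : Type*} [Fintype U] {φ : U → V} {m : U → U → ℕ}
    (hm : ∀ u v, m u v = m v u) (a b : V) : matPush φ m a b = matPush φ m b a := by
  unfold matPush
  refine Fintype.sum_equiv (Equiv.prodComm U U) _ _ fun p => ?_
  simp only [Equiv.prodComm_apply, Prod.fst_swap, Prod.snd_swap, hm p.1 p.2, and_comm]

/-! ### Cuts in weighted graphs -/

/-- The weighted adjacency matrix. -/
noncomputable def wAdj {V : Type*} (G : SimpleGraph V) (w : Sym2 V → ℕ) (a b : V) : ℕ :=
  if G.Adj a b then w s(a, b) else 0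

lemma wAdj_symm {V : Type*} (G : SimpleGraph V) (w : Sym2 V → ℕ) (a b : V) :
    wAdj G w a b = wAdj G w b a := by
  simp only [wAdj, G.adj_comm a b, Sym2.eq_swap (a := a) (b := b)]

/-- The weight of the edge boundary of `Y`. -/
noncomputable def cutW {V : Type*} [Fintype V] (G : SimpleGraph V) (w : Sym2 V → ℕ)
    (Y : Set V) : ℕ :=
  matCut (wAdj G w) Y

lemma cutW_compl {V : Type*} [Fintype V] (G : SimpleGraph V) (w : Sym2 V → ℕ) (Y : Set V) :
    cutW G w Yᶜ = cutW G w Y := by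
  refine Fintype.sum_equiv (Equiv.prodComm V V) _ _ fun p => ?_
  simp only [Equiv.prodComm_apply, Prod.fst_swap, Prod.snd_swap, wAdj_symm G w p.1 p.2,
    Set.mem_compl_iff, not_not, and_comm]

@[simp] lemma cutW_empty {V : Type*} [Fintype V] (G : SimpleGraph V) (w : Sym2 V → ℕ) :
    cutW G w ∅ = 0 := by
  simp [cutW, matCut]

lemma cutW_reachable_eq_zero {V : Type*} [Fintype V] (G : SimpleGraph V) (w : Sym2 V → ℕ)
    (a : V) : cutW G w {v | G.Reachable a v} = 0 :=
  Finset.sum_eq_zero fun p _ => by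
    split_ifs with hp
    · refine if_neg fun h => hp.2 ?_
      exact SimpleGraph.Reachable.trans hp.1 h.reachable
    · rfl

lemma cutW_inter_reachable_le {V : Type*} [Fintype V] (G : SimpleGraph V) (w : Sym2 V → ℕ)
    (a : V) (Y : Set V) : cutW G w (Y ∩ {v | G.Reachable a v}) ≤ cutW G w Y := by
  refine Finset.sum_le_sum fun p _ => ?_
  split_ifs with h1 h2 h2
  · rfl
  · refine (if_neg fun h => ?_).le
    have h3 : G.Reachable a p.2 := SimpleGraph.Reachable.trans h1.1.2 h.reachable
    exact h2 ⟨h1.1.1, fun h4 => h1.2 ⟨h4, h3⟩⟩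
  · exact Nat.zero_le _
  · rfl

lemma mem_of_reachable_of_cutW_eq_zero {V : Type*} [Fintype V] {G : SimpleGraph V}
    {w : Sym2 V → ℕ} (hw : ∀ e ∈ G.edgeSet, 0 < w e) {Y : Set V} (hY : cutW G w Y = 0)
    {a b : V} (hab : G.Reachable a b) (ha : a ∈ Y) : b ∈ Y := by
  obtain ⟨W⟩ := hab
  induction W with
  | nil => exact ha
  | @cons u v _ h _ ih =>
    refine ih ?_
    by_contra hv
    have h1 := (Finset.sum_eq_zero_iff.1 hY) (u, v) (Finset.mem_univ _)
    simp only [ha, hv, not_false_iff, and_self, if_true, wAdj, h] at h1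
    exact (hw s(u, v) h).ne' h1

/-- The least weight of a cut separating two vertices of the component of `a`. -/
noncomputable def splitInf {V : Type*} [Fintype V] (G : SimpleGraph V) (w : Sym2 V → ℕ)
    (a : V) : ℕ∞ :=
  ⨅ Y ∈ {Y : Set V | ∃ c d, G.Reachable a c ∧ G.Reachable a d ∧ c ∈ Y ∧ d ∉ Y},
    (cutW G w Y : ℕ∞)

lemma le_splitInf {V : Type*} [Fintype V] {G : SimpleGraph V} {w : Sym2 V → ℕ} {a : V}
    {k : ℕ∞} : k ≤ splitInf G w a ↔
      ∀ (Y : Set V) (c d : V), G.Reachable a c → G.Reachable a d → c ∈ Y → d ∉ Y →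
        k ≤ (cutW G w Y : ℕ∞) := by
  simp only [splitInf, le_iInf_iff, Set.mem_ofPred_eq]
  constructor
  · intro h Y c d hc hd hcY hdY
    exact h Y ⟨c, d, hc, hd, hcY, hdY⟩
  · rintro h Y ⟨c, d, hc, hd, hcY, hdY⟩
    exact h Y c d hc hd hcY hdY

/-- Distinct edges crossing `Y` contribute distinct terms to the cut weight of `Y`. -/
lemma sum_le_cutW {V : Type*} [Fintype V] {U : Type*} (ι : U ↪ V) (G : SimpleGraph V)
    (w : Sym2 V → ℕ) (Y : Set V) (S : Finset (Sym2 U))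
    (hS : ∀ e ∈ S, ∃ u v, e = s(u, v) ∧ ι u ∈ Y ∧ ι v ∉ Y ∧ G.Adj (ι u) (ι v)) :
    ∑ e ∈ S, w (Sym2.map ι e) ≤ cutW G w Y := by
  rcases S.eq_empty_or_nonempty with rfl | ⟨e₀, he₀⟩
  · simp
  have : Nonempty U := ⟨(hS e₀ he₀).choose⟩
  choose! u v he hu hv hadj using hS
  have hinj : Set.InjOn (fun e => ((ι (u e), ι (v e)) : V × V)) (S : Set (Sym2 U)) := by
    intro e h e' h' heq
    simp only [Prod.mk.injEq, ι.injective.eq_iff] at heq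
    rw [he e h, he e' h', heq.1, heq.2]
  calc ∑ e ∈ S, w (Sym2.map ι e)
      = ∑ p ∈ S.image (fun e => ((ι (u e), ι (v e)) : V × V)),
          if p.1 ∈ Y ∧ p.2 ∉ Y then wAdj G w p.1 p.2 else 0 := by
        rw [Finset.sum_image hinj]
        refine Finset.sum_congr rfl fun e h => ?_
        rw [if_pos ⟨hu e h, hv e h⟩, wAdj, if_pos (hadj e h)]
        conv_lhs => rw [he e h]
        rfl
    _ ≤ cutW G w Y :=
        Finset.sum_le_sum_of_subset (Finset.subset_univ _)

/-- An edge set containing all edges that cross `Y` weighs at least the cut weight of `Y`. -/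
lemma cutW_le_sum {V : Type*} [Fintype V] {U : Type*} (ι : U ↪ V) (G : SimpleGraph V)
    (w : Sym2 V → ℕ) (Y : Set V) (S : Finset (Sym2 U))
    (hS : ∀ a b, a ∈ Y → b ∉ Y → G.Adj a b → ∃ u v, ι u = a ∧ ι v = b ∧ s(u, v) ∈ S) :
    cutW G w Y ≤ ∑ e ∈ S, w (Sym2.map ι e) := by
  set T : Finset (V × V) := Finset.univ.filter fun p => p.1 ∈ Y ∧ p.2 ∉ Y ∧ G.Adj p.1 p.2
    with hT
  have hcut : cutW G w Y = ∑ p ∈ T, w s(p.1, p.2) := by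
    rw [hT, Finset.sum_filter]
    refine Finset.sum_congr rfl fun p _ => ?_
    by_cases h1 : p.1 ∈ Y <;> by_cases h2 : p.2 ∈ Y <;> simp [h1, h2, wAdj]
  have hmem : ∀ p ∈ T, s(p.1, p.2) ∈ S.image (Sym2.map ι) := by
    intro p hp
    obtain ⟨-, h1, h2, h3⟩ := Finset.mem_filter.1 hp
    obtain ⟨u, v, hu, hv, h⟩ := hS _ _ h1 h2 h3
    exact Finset.mem_image.2 ⟨_, h, by rw [Sym2.map_mk, ← hu, ← hv]⟩
  have hinj : Set.InjOn (fun p : V × V => s(p.1, p.2)) (T : Set (V × V)) := by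
    rintro ⟨a, b⟩ hp ⟨c, d⟩ hq h
    have hp := Finset.mem_filter.1 hp
    have hq := Finset.mem_filter.1 hq
    rcases Sym2.eq_iff.1 h with ⟨h1, h2⟩ | ⟨h1, h2⟩
    · exact Prod.ext h1 h2
    · exact absurd (h1 ▸ hp.2.1) hq.2.2.1
  have hιinj : Function.Injective (Sym2.map ι) := Sym2.map.injective ι.injective
  rw [hcut, ← Finset.sum_image (f := w) hinj, ← Finset.sum_image (f := w) hιinj.injOn]
  refine Finset.sum_le_sum_of_subset fun e h => ?_
  obtain ⟨p, hp, rfl⟩ := Finset.mem_image.1 h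
  exact hmem p hp

lemma compConn_eq_splitInf {V : Type*} [Fintype V] (G : SimpleGraph V) (w : Sym2 V → ℕ)
    (a : V) : compConn G w (G.connectedComponentMk a).supp = splitInf G w a := by
  set C := (G.connectedComponentMk a).supp with hC
  have hmem : ∀ v, v ∈ C ↔ G.Reachable a v := fun v => by
    rw [hC, SimpleGraph.ConnectedComponent.mem_supp_iff, SimpleGraph.ConnectedComponent.eq]
    exact SimpleGraph.reachable_comm
  have key : ∀ k : ℕ∞, (∀ S : Finset (Sym2 C), ↑S ⊆ (G.induce C).edgeSet →
      (∑ e ∈ S, (w (Sym2.map Subtype.val e) : ℕ∞)) < k →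
        ((G.induce C).deleteEdges ↑S).Connected) ↔ k ≤ splitInf G w a := by
    intro k
    rw [le_splitInf]
    constructor
    · intro h Y c d hc hd hcY hdY
      by_contra hlt
      rw [not_le] at hlt
      set S : Finset (Sym2 C) := (G.induce C).edgeFinset.filter
        fun e => ∃ u v, e = s(u, v) ∧ u.1 ∈ Y ∧ v.1 ∉ Y with hSdef
      have hS : ∀ e ∈ S, ∃ u v, e = s(u, v) ∧ (Function.Embedding.subtype (· ∈ C)) u ∈ Y ∧
          (Function.Embedding.subtype (· ∈ C)) v ∉ Y ∧
          G.Adj ((Function.Embedding.subtype (· ∈ C)) u)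
            ((Function.Embedding.subtype (· ∈ C)) v) := by
        intro e he
        obtain ⟨he, u, v, rfl, hu, hv⟩ := Finset.mem_filter.1 he
        rw [SimpleGraph.mem_edgeFinset] at he
        exact ⟨u, v, rfl, hu, hv, he⟩
      have hle := sum_le_cutW (Function.Embedding.subtype (· ∈ C)) G w Y S hS
      have hconn := h S (fun e he => by
        have := (Finset.mem_filter.1 (Finset.mem_coe.1 he)).1
        exact SimpleGraph.mem_edgeFinset.1 this) (lt_of_le_of_lt (by exact_mod_cast hle) hlt)
      have hreach := hconn.preconnected ⟨c, (hmem c).2 hc⟩ ⟨d, (hmem d).2 hd⟩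
      have hstay : ∀ u v : C, ((G.induce C).deleteEdges ↑S).Reachable u v →
          u.1 ∈ Y → v.1 ∈ Y := by
        rintro u v ⟨W⟩ hu
        induction W with
        | nil => exact hu
        | @cons u v _ hadj _ ih =>
          refine ih ?_
          by_contra hv
          rw [SimpleGraph.deleteEdges_adj] at hadj
          exact hadj.2 (Finset.mem_coe.2 (Finset.mem_filter.2
            ⟨SimpleGraph.mem_edgeFinset.2 hadj.1, u, v, rfl, hu, hv⟩))
      exact hdY (hstay _ _ hreach hcY)
    · intro h S hS hlt
      have : Nonempty C := ⟨⟨a, (hmem a).2 (SimpleGraph.Reachable.refl a)⟩⟩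
      refine ⟨?_⟩
      intro u v
      by_contra huv
      set Y : Set V := {z | ∃ hz : z ∈ C, ((G.induce C).deleteEdges ↑S).Reachable u ⟨z, hz⟩}
        with hY
      have hle := cutW_le_sum (Function.Embedding.subtype (· ∈ C)) G w Y S (by
        rintro b d ⟨hb, hub⟩ hd hadj
        have hdC : d ∈ C := (hmem d).2 (((hmem b).1 hb).trans hadj.reachable)
        refine ⟨⟨b, hb⟩, ⟨d, hdC⟩, rfl, rfl, ?_⟩
        by_contra hmemS
        refine hd ⟨hdC, hub.trans (SimpleGraph.Adj.reachable ?_)⟩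
        rw [SimpleGraph.deleteEdges_adj]
        exact ⟨hadj, hmemS⟩)
      have h1 := h Y u.1 v.1 ((hmem _).1 u.2) ((hmem _).1 v.2)
        ⟨u.2, SimpleGraph.Reachable.refl u⟩ (fun ⟨_, hv⟩ => huv hv)
      have h2 : (cutW G w Y : ℕ∞) ≤ ∑ e ∈ S, (w (Sym2.map Subtype.val e) : ℕ∞) := by
        exact_mod_cast hle
      exact absurd hlt (not_lt.2 (h1.trans h2))
  unfold compConn weightConn
  have hset : {k : ℕ∞ | ∀ S : Finset (Sym2 C), ↑S ⊆ (G.induce C).edgeSet →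
      (∑ e ∈ S, (w (Sym2.map Subtype.val e) : ℕ∞)) < k →
        ((G.induce C).deleteEdges ↑S).Connected} = Set.Iic (splitInf G w a) :=
    Set.ext key
  rw [hset]
  exact csSup_Iic

/-- A contraction of vertices inside components that keeps, for every cut, one that splits the
same component and is no heavier preserves the connectivities of all components. -/
lemma connMultiset_eq_of_contraction {V V' : Type*} [Fintype V] [Fintype V']
    {G : SimpleGraph V} {G' : SimpleGraph V'} {w : Sym2 V → ℕ} {w' : Sym2 V' → ℕ}
    (hw : ∀ e ∈ G.edgeSet, 0 < w e) (hw' : ∀ e ∈ G'.edgeSet, 0 < w' e)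
    {Q : V → V'} (hQ : Q.Surjective) (hcut : ∀ Y', cutW G' w' Y' = cutW G w (Q ⁻¹' Y'))
    (hfib : ∀ u v, Q u = Q v → G.Reachable u v)
    (hsat : ∀ (Y : Set V) (a b : V), G.Reachable a b → a ∈ Y → b ∉ Y →
      ∃ (Y' : Set V') (c d : V), G.Reachable a c ∧ G.Reachable a d ∧ Q c ∈ Y' ∧ Q d ∉ Y' ∧
        cutW G w (Q ⁻¹' Y') ≤ cutW G w Y) :
    connMultiset G w = connMultiset G' w' := by
  have hreach : ∀ a b, G'.Reachable (Q a) (Q b) ↔ G.Reachable a b := by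
    intro a b
    constructor
    · intro h
      have hpre : Q ⁻¹' (Q '' {v | G.Reachable a v}) = {v | G.Reachable a v} := by
        refine Set.Subset.antisymm ?_ (Set.subset_preimage_image _ _)
        rintro v ⟨u, hu, huv⟩
        exact SimpleGraph.Reachable.trans hu (hfib u v huv)
      have h0 : cutW G' w' (Q '' {v | G.Reachable a v}) = 0 := by
        rw [hcut, hpre, cutW_reachable_eq_zero]
      have h1 := mem_of_reachable_of_cutW_eq_zero hw' h0 h
        ⟨a, SimpleGraph.Reachable.refl a, rfl⟩
      rw [← Set.mem_preimage, hpre] at h1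
      exact h1
    · intro h
      have h0 : cutW G w (Q ⁻¹' {v | G'.Reachable (Q a) v}) = 0 := by
        rw [← hcut, cutW_reachable_eq_zero]
      exact mem_of_reachable_of_cutW_eq_zero hw h0 h (SimpleGraph.Reachable.refl (Q a))
  have hsplit : ∀ a, splitInf G w a = splitInf G' w' (Q a) := by
    intro a
    refine le_antisymm (le_splitInf.2 ?_) (le_splitInf.2 ?_)
    · intro Y c d hc hd hcY hdY
      obtain ⟨c, rfl⟩ := hQ c
      obtain ⟨d, rfl⟩ := hQ d
      rw [hcut]
      exact le_splitInf.1 le_rfl _ c d ((hreach _ _).1 hc) ((hreach _ _).1 hd) hcY hdY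
    · intro Y c d hc hd hcY hdY
      obtain ⟨Y', c', d', hc', hd', hcY', hdY', hle⟩ := hsat Y c d (hc.symm.trans hd) hcY hdY
      refine le_trans (le_splitInf.1 le_rfl Y' (Q c') (Q d') ((hreach _ _).2 (hc.trans hc'))
        ((hreach _ _).2 (hc.trans hd')) hcY' hdY') ?_
      rw [hcut]
      exact_mod_cast hle
  let f : G.ConnectedComponent → G'.ConnectedComponent :=
    Quot.map Q fun a b h => (hreach a b).2 h
  have hf : f.Bijective := by
    constructor
    · intro c d
      induction c using SimpleGraph.ConnectedComponent.ind with | _ a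
      induction d using SimpleGraph.ConnectedComponent.ind with | _ b
      intro h
      exact SimpleGraph.ConnectedComponent.eq.2
        ((hreach a b).1 (SimpleGraph.ConnectedComponent.eq.1 h))
    · intro d
      induction d using SimpleGraph.ConnectedComponent.ind with | _ b
      obtain ⟨a, rfl⟩ := hQ b
      exact ⟨G.connectedComponentMk a, rfl⟩
  let _ : Fintype G.ConnectedComponent := Fintype.ofFinite _
  let _ : Fintype G'.ConnectedComponent := Fintype.ofFinite _
  have huniv := congrArg Finset.val (Finset.map_univ_equiv (Equiv.ofBijective f hf))
  rw [Finset.map_val] at huniv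
  unfold connMultiset
  rw [← huniv, Multiset.map_map]
  refine Multiset.map_congr rfl fun c _ => ?_
  induction c using SimpleGraph.ConnectedComponent.ind with | _ a
  exact (compConn_eq_splitInf G w a).trans
    ((hsplit a).trans (compConn_eq_splitInf G' w' (Q a)).symm)

/-! ### Cuts in boundary sums -/

section BSum

variable {VF VH : Type*} {r : ℕ}

/-- The inclusion of the second summand into a boundary sum. -/
noncomputable def bsumInr (y : Fin r → VF) (x : Fin r → VH) (v : VH) :
    VF ⊕ {v : VH // v ∉ Set.range x} :=
  if h : v ∈ Set.range x then Sum.inl (y h.choose) else Sum.inr ⟨v, h⟩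

lemma bsumInr_boundary (y : Fin r → VF) (x : Fin r ↪ VH) (i : Fin r) :
    bsumInr y x (x i) = Sum.inl (y i) := by
  have h : x i ∈ Set.range x := ⟨i, rfl⟩
  rw [bsumInr, dif_pos h, x.injective h.choose_spec]

lemma bsumInr_inner (y : Fin r → VF) (x : Fin r → VH) (v : {v : VH // v ∉ Set.range x}) :
    bsumInr y x v.1 = Sum.inr v := by
  rw [bsumInr, dif_neg v.2]

lemma eq_of_bsumInr_eq_inl {y : Fin r → VF} {x : Fin r ↪ VH} {v : VH} {a : VF}
    (h : bsumInr y x v = Sum.inl a) : ∃ i, v = x i ∧ y i = a := by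
  by_cases hv : v ∈ Set.range x
  · obtain ⟨i, rfl⟩ := hv
    rw [bsumInr_boundary] at h
    exact ⟨i, rfl, Sum.inl.inj h⟩
  · rw [bsumInr_inner y x ⟨v, hv⟩] at h
    cases h

lemma eq_of_bsumInr_eq_inr {y : Fin r → VF} {x : Fin r ↪ VH} {v : VH}
    {b : {v : VH // v ∉ Set.range x}} (h : bsumInr y x v = Sum.inr b) : v = b.1 := by
  by_cases hv : v ∈ Set.range x
  · obtain ⟨i, rfl⟩ := hv
    rw [bsumInr_boundary] at h
    cases h
  · rw [bsumInr_inner y x ⟨v, hv⟩] at h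
    exact congrArg Subtype.val (Sum.inr.inj h)

lemma bsumInr_injective (y : Fin r ↪ VF) (x : Fin r ↪ VH) :
    Function.Injective (bsumInr y x) := by
  intro u v h
  rcases hv : bsumInr y x v with a | b
  · obtain ⟨i, rfl, hi⟩ := eq_of_bsumInr_eq_inl (h.trans hv)
    obtain ⟨j, rfl, hj⟩ := eq_of_bsumInr_eq_inl hv
    rw [y.injective (hi.trans hj.symm)]
  · rw [eq_of_bsumInr_eq_inr (h.trans hv), eq_of_bsumInr_eq_inr hv]

variable {F : SimpleGraph VF} {H : SimpleGraph VH} {wF : Sym2 VF → ℕ} {wH : Sym2 VH → ℕ}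
  {y : Fin r ↪ VF} {x : Fin r ↪ VH}

lemma bsum_adj_inl_inl {a b : VF} : (BSum F y H x).Adj (.inl a) (.inl b) ↔ F.Adj a b := by
  simp only [BSum, SimpleGraph.fromRel_adj, F.adj_comm b a, or_self, ne_eq, Sum.inl.injEq]
  exact ⟨fun h => h.2, fun h => ⟨h.ne, h⟩⟩

lemma bsum_adj_inr_inr {a b : {v : VH // v ∉ Set.range x}} :
    (BSum F y H x).Adj (.inr a) (.inr b) ↔ H.Adj a.1 b.1 := by
  simp only [BSum, SimpleGraph.fromRel_adj, H.adj_comm b.1 a.1, or_self, ne_eq, Sum.inr.injEq]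
  exact ⟨fun h => h.2, fun h => ⟨fun e => h.ne (congrArg _ e), h⟩⟩

lemma bsum_adj_inl_inr {a : VF} {b : {v : VH // v ∉ Set.range x}} :
    (BSum F y H x).Adj (.inl a) (.inr b) ↔ ∃ i, y i = a ∧ H.Adj (x i) b.1 := by
  simp [BSum, SimpleGraph.fromRel_adj]

lemma bsumW_inl_inr {i : Fin r} {b : {v : VH // v ∉ Set.range x}} :
    BSumW wF wH y x s(.inl (y i), .inr b) = wH s(x i, b.1) := by
  change (∑ j : Fin r, if y j = y i then wH s(x j, b.1) else 0) = _
  simp [y.injective.eq_iff]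

lemma bsumW_pos (hwF : ∀ e ∈ F.edgeSet, 0 < wF e) (hwH : ∀ e ∈ H.edgeSet, 0 < wH e) :
    ∀ e ∈ (BSum F y H x).edgeSet, 0 < BSumW wF wH y x e := by
  have hmix : ∀ a b, (BSum F y H x).Adj (.inl a) (.inr b) →
      0 < BSumW wF wH y x s(.inl a, .inr b) := by
    intro a b h
    obtain ⟨i, rfl, hi⟩ := bsum_adj_inl_inr.1 h
    rw [bsumW_inl_inr]
    exact hwH _ hi
  intro e
  induction e using Sym2.ind with | _ a b
  rw [SimpleGraph.mem_edgeSet]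
  intro h
  rcases a with a | a <;> rcases b with b | b
  · exact hwF s(a, b) (bsum_adj_inl_inl.1 h)
  · exact hmix a b h
  · rw [Sym2.eq_swap]
    exact hmix b a h.symm
  · exact hwH s(a.1, b.1) (bsum_adj_inr_inr.1 h)

lemma cutW_bsum [Fintype VF] [Fintype VH] [Fintype {v : VH // v ∉ Set.range x}]
    (hx : ∀ i j, ¬ H.Adj (x i) (x j))
    (Y : Set (VF ⊕ {v : VH // v ∉ Set.range x})) :
    cutW (BSum F y H x) (BSumW wF wH y x) Y =
      cutW F wF (Sum.inl ⁻¹' Y) + cutW H wH (bsumInr y x ⁻¹' Y) := by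
  unfold cutW
  rw [← matCut_push, ← matCut_push, ← matCut_add]
  have hmix : ∀ a b, wAdj (BSum F y H x) (BSumW wF wH y x) (.inl a) (.inr b) =
      matPush Sum.inl (wAdj F wF) (.inl a) (.inr b) +
        matPush (bsumInr y x) (wAdj H wH) (.inl a) (.inr b) := by
    intro a b
    rw [matPush_eq_zero (φ := Sum.inl) (fun _ _ _ h => by cases h), zero_add]
    by_cases ha : ∃ i, y i = a
    · obtain ⟨i, rfl⟩ := ha
      have h1 := matPush_apply (bsumInr_injective y x) (wAdj H wH) (x i) b.1
      rw [bsumInr_boundary, bsumInr_inner] at h1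
      rw [h1]
      unfold wAdj
      rw [bsumW_inl_inr]
      refine if_congr ?_ rfl rfl
      rw [bsum_adj_inl_inr]
      exact ⟨fun ⟨j, hj, h⟩ => y.injective hj ▸ h, fun h => ⟨i, rfl, h⟩⟩
    · rw [matPush_eq_zero]
      · refine if_neg fun h => ha ?_
        obtain ⟨i, hi, -⟩ := bsum_adj_inl_inr.1 h
        exact ⟨i, hi⟩
      · intro u v hu
        obtain ⟨i, -, hi⟩ := eq_of_bsumInr_eq_inl hu
        exact absurd ⟨i, hi⟩ ha
  refine matCut_congr fun a b _ => ?_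
  rcases a with a | a <;> rcases b with b | b
  · rw [matPush_apply Sum.inl_injective, matPush_eq_zero (φ := bsumInr y x), add_zero]
    · exact if_congr bsum_adj_inl_inl rfl rfl
    · intro u v hu hv
      obtain ⟨i, rfl, -⟩ := eq_of_bsumInr_eq_inl hu
      obtain ⟨j, rfl, -⟩ := eq_of_bsumInr_eq_inl hv
      exact if_neg (hx i j)
  · exact hmix a b
  · rw [wAdj_symm, matPush_symm (wAdj_symm F wF), matPush_symm (wAdj_symm H wH)]
    exact hmix b a
  · have h1 := matPush_apply (bsumInr_injective y x) (wAdj H wH) a.1 b.1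
    rw [bsumInr_inner, bsumInr_inner] at h1
    rw [matPush_eq_zero (φ := Sum.inl) (fun _ _ h => by cases h), h1, zero_add]
    exact if_congr bsum_adj_inr_inr rfl rfl

lemma bsum_reachable_of_reachable [Fintype VF] [Fintype VH]
    (hx : ∀ i j, ¬ H.Adj (x i) (x j)) (hwH : ∀ e ∈ H.edgeSet, 0 < wH e) {u v : VH}
    (h : H.Reachable u v) : (BSum F y H x).Reachable (bsumInr y x u) (bsumInr y x v) := by
  have h0 := cutW_reachable_eq_zero (BSum F y H x) (BSumW 0 wH y x) (bsumInr y x u)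
  rw [cutW_bsum hx] at h0
  exact mem_of_reachable_of_cutW_eq_zero hwH (Nat.add_eq_zero_iff.1 h0).2 h
    (SimpleGraph.Reachable.refl (bsumInr y x u))

end BSum

/-! ### Contracting weighted graphs -/

/-- The graph obtained by identifying vertices along `q`, dropping loops. -/
def contractGraph {U V : Type*} (q : U → V) (H : SimpleGraph U) : SimpleGraph V where
  Adj a b := a ≠ b ∧ ∃ u v, q u = a ∧ q v = b ∧ H.Adj u v
  symm := ⟨fun _ _ ⟨h, u, v, hu, hv, huv⟩ => ⟨h.symm, v, u, hv, hu, huv.symm⟩⟩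
  loopless := ⟨fun _ h => h.1 rfl⟩

/-- The weights of the contracted graph, in which weights of parallel edges add up. -/
noncomputable def contractWeight {U V : Type*} [Fintype U] (q : U → V) (H : SimpleGraph U)
    (w : Sym2 U → ℕ) : Sym2 V → ℕ :=
  Sym2.lift ⟨matPush q (wAdj H w), matPush_symm (wAdj_symm H w)⟩

lemma contract_reachable {U V : Type*} {q : U → V} {H : SimpleGraph U} {u v : U}
    (h : H.Reachable u v) :
    (contractGraph q H).Reachable (q u) (q v) := by
  obtain ⟨W⟩ := h
  induction W with
  | nil => exact SimpleGraph.Reachable.refl _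
  | @cons a b _ hadj _ ih =>
    by_cases hq : q a = q b
    · rwa [hq]
    · have hab : (contractGraph q H).Adj (q a) (q b) := ⟨hq, a, b, rfl, rfl, hadj⟩
      exact hab.reachable.trans ih

section Contract

variable {U V : Type*} [Fintype U] {q : U → V} {H : SimpleGraph U} {w : Sym2 U → ℕ}

lemma contractWeight_pos (hw : ∀ e ∈ H.edgeSet, 0 < w e) :
    ∀ e ∈ (contractGraph q H).edgeSet, 0 < contractWeight q H w e := by
  intro e
  induction e using Sym2.ind with | _ a b
  rintro ⟨-, u, v, rfl, rfl, h⟩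
  change 0 < matPush q (wAdj H w) (q u) (q v)
  refine lt_of_lt_of_le (hw s(u, v) h) ?_
  have h1 := Finset.single_le_sum (s := Finset.univ)
    (f := fun p : U × U => if q p.1 = q u ∧ q p.2 = q v then wAdj H w p.1 p.2 else 0)
    (fun _ _ => Nat.zero_le _) (Finset.mem_univ (u, v))
  simpa [matPush, wAdj, h] using h1

lemma cutW_contract [Fintype V] (Y : Set V) :
    cutW (contractGraph q H) (contractWeight q H w) Y = cutW H w (q ⁻¹' Y) := by
  unfold cutW
  rw [← matCut_push]
  refine matCut_congr fun a b hab => ?_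
  by_cases h : (contractGraph q H).Adj a b
  · exact if_pos h
  · rw [wAdj, if_neg h, matPush_eq_zero]
    intro u v hu hv
    exact if_neg fun huv => h ⟨hab, u, v, hu, hv, huv⟩

end Contract

/-! ### Contractions that preserve minimum cuts -/

section Mimic

variable {VH : Type*} [Fintype VH] {r : ℕ} (H : SimpleGraph VH) (wH : Sym2 VH → ℕ)
  (x : Fin r ↪ VH)

lemma exists_min_boundary_cut (A : Set (Fin r)) :
    ∃ X : Set VH, x ⁻¹' X = A ∧ ∀ Z : Set VH, x ⁻¹' Z = A → cutW H wH X ≤ cutW H wH Z := by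
  obtain ⟨X, hX, hmin⟩ := Set.exists_min_image {X : Set VH | x ⁻¹' X = A} (cutW H wH)
    (Set.toFinite _) ⟨x '' A, Set.preimage_image_eq A x.injective⟩
  exact ⟨X, hX, hmin⟩

/-- There is a set of interior vertices whose trace on every component `K` with interior vertices
is a minimum cut among the nonempty sets of interior vertices of `K`. -/
lemma exists_min_interior_cut :
    ∃ X : Set VH, ∀ (u : VH) (Z : Set VH), Z.Nonempty → Z ⊆ {v | H.Reachable u v} →
      x ⁻¹' Z = ∅ → (X ∩ {v | H.Reachable u v}).Nonempty ∧
        x ⁻¹' (X ∩ {v | H.Reachable u v}) = ∅ ∧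
        cutW H wH (X ∩ {v | H.Reachable u v}) ≤ cutW H wH Z := by
  have h : ∀ K : H.ConnectedComponent, ∃ X : Set VH, X ⊆ K.supp ∧
      ∀ Z : Set VH, Z.Nonempty → Z ⊆ K.supp → x ⁻¹' Z = ∅ →
        X.Nonempty ∧ x ⁻¹' X = ∅ ∧ cutW H wH X ≤ cutW H wH Z := by
    intro K
    by_cases hne : {Z : Set VH | Z.Nonempty ∧ Z ⊆ K.supp ∧ x ⁻¹' Z = ∅}.Nonempty
    · obtain ⟨X, hX, hmin⟩ := Set.exists_min_image _ (cutW H wH) (Set.toFinite _) hne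
      exact ⟨X, hX.2.1, fun Z h1 h2 h3 => ⟨hX.1, hX.2.2, hmin Z ⟨h1, h2, h3⟩⟩⟩
    · exact ⟨∅, Set.empty_subset _, fun Z h1 h2 h3 => absurd ⟨Z, h1, h2, h3⟩ hne⟩
  choose M hM hmin using h
  refine ⟨⋃ K, M K, fun u => ?_⟩
  have hsupp : {v | H.Reachable u v} = (H.connectedComponentMk u).supp := by
    ext v
    rw [SimpleGraph.ConnectedComponent.mem_supp_iff, SimpleGraph.ConnectedComponent.eq]
    exact SimpleGraph.reachable_comm
  have htrace : (⋃ K, M K) ∩ {v | H.Reachable u v} = M (H.connectedComponentMk u) := by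
    rw [hsupp]
    ext v
    constructor
    · rintro ⟨hv, hvu⟩
      obtain ⟨K, hK⟩ := Set.mem_iUnion.1 hv
      have h1 : H.connectedComponentMk v = K := hM K hK
      have h2 : H.connectedComponentMk v = H.connectedComponentMk u := hvu
      rwa [← h2, h1]
    · intro hv
      exact ⟨Set.mem_iUnion.2 ⟨_, hv⟩, hM _ hv⟩
  rw [htrace, hsupp]
  exact hmin _

/-- A family of sets, one for every pair of complementary sets of boundary indices, whose common
refinement preserves minimum cuts. -/
lemma exists_cut_signature (hwH : ∀ e ∈ H.edgeSet, 0 < wH e) (hx : ProperB H x) :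
    ∃ σ : VH → Set (Set (Fin (r - 1))),
      (∀ u v, σ u = σ v → H.Reachable u v) ∧
      (∀ X : Set VH, ∃ Z : Set VH, (∀ u v, σ u = σ v → u ∈ Z → v ∈ Z) ∧ x ⁻¹' Z = x ⁻¹' X ∧
        cutW H wH Z ≤ cutW H wH X) ∧
      (∀ (X : Set VH) (u : VH), u ∈ X → (∀ i, H.Reachable u (x i) → x i ∉ X) →
        ∃ Z : Set VH, (∀ u v, σ u = σ v → u ∈ Z → v ∈ Z) ∧ x ⁻¹' Z = ∅ ∧ Z.Nonempty ∧
          Z ⊆ {v | H.Reachable u v} ∧ cutW H wH Z ≤ cutW H wH X) := by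
  choose N hN hNmin using exists_min_boundary_cut H wH x
  obtain ⟨M₀, hM₀⟩ := exists_min_interior_cut H wH x
  let M : Set (Fin r) → Set VH := fun A => if A = ∅ then M₀ else N A
  let shift : Set (Fin (r - 1)) → Set (Fin r) := fun B => {i | ∃ j ∈ B, j.1 + 1 = i.1}
  let σ : VH → Set (Set (Fin (r - 1))) := fun v => {B | v ∈ M (shift B)}
  have hσ : ∀ A : Set (Fin r), (∀ i ∈ A, i.1 ≠ 0) → ∀ u v, σ u = σ v → u ∈ M A → v ∈ M A := by
    intro A hA u v huv hu
    have hshift : shift {j | (⟨j.1 + 1, by have := j.2; omega⟩ : Fin r) ∈ A} = A := by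
      ext i
      constructor
      · rintro ⟨j, hj, hji⟩
        have hi : (⟨j.1 + 1, by have := j.2; omega⟩ : Fin r) = i := Fin.ext hji
        exact hi ▸ hj
      · intro hi
        have h0 := hA i hi
        have h1 := i.2
        refine ⟨⟨i.1 - 1, by omega⟩, ?_, by simp only; omega⟩
        have hi' : (⟨i.1 - 1 + 1, by omega⟩ : Fin r) = i := Fin.ext (by simp only; omega)
        change (⟨i.1 - 1 + 1, _⟩ : Fin r) ∈ A
        rwa [hi']
    rw [← hshift] at hu ⊢
    have h2 : _ ∈ σ u := hu
    rw [huv] at h2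
    exact h2
  have hσN : ∀ A : Set (Fin r), A.Nonempty → (∀ i ∈ A, i.1 ≠ 0) →
      ∀ u v, σ u = σ v → u ∈ N A → v ∈ N A := by
    intro A hne hA
    have h := hσ A hA
    simpa only [M, if_neg hne.ne_empty] using h
  have hσ₀ : ∀ u v, σ u = σ v → u ∈ M₀ → v ∈ M₀ := by
    have h := hσ ∅ (fun i hi => absurd hi (Set.notMem_empty i))
    simpa only [M, if_true] using h
  have hcomp : ∀ u v, σ u = σ v → (∀ i, H.Reachable u (x i) → i.1 ≠ 0) →
      H.Reachable u v := by
    intro u v huv h0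
    obtain ⟨i, hi⟩ := hx.2 u
    obtain ⟨j, hj⟩ := hx.2 v
    have hcut : cutW H wH (N {i | H.Reachable u (x i)}) = 0 := by
      have h1 := hNmin {i | H.Reachable u (x i)} {v | H.Reachable u v} rfl
      rw [cutW_reachable_eq_zero] at h1
      exact Nat.le_zero.1 h1
    have hiN : x i ∈ N {i | H.Reachable u (x i)} := by
      rw [← Set.mem_preimage, hN]
      exact hi
    have huN := mem_of_reachable_of_cutW_eq_zero hwH hcut hi.symm hiN
    have hvN := hσN _ ⟨i, hi⟩ h0 u v huv huN
    have hjN := mem_of_reachable_of_cutW_eq_zero hwH hcut hj hvN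
    rw [← Set.mem_preimage, hN] at hjN
    exact SimpleGraph.Reachable.trans hjN hj.symm
  have hreach : ∀ u v, σ u = σ v → H.Reachable u v := by
    intro u v huv
    by_cases hu : ∀ i, H.Reachable u (x i) → i.1 ≠ 0
    · exact hcomp u v huv hu
    by_cases hv : ∀ i, H.Reachable v (x i) → i.1 ≠ 0
    · exact (hcomp v u huv.symm hv).symm
    push Not at hu hv
    obtain ⟨i, hi, hi0⟩ := hu
    obtain ⟨j, hj, hj0⟩ := hv
    have hij : i = j := Fin.ext (hi0.trans hj0.symm)
    exact hi.trans (hij ▸ hj.symm)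
  have hlow : ∀ X : Set VH, (∀ i, x i ∈ X → i.1 ≠ 0) →
      ∃ Z : Set VH, (∀ u v, σ u = σ v → u ∈ Z → v ∈ Z) ∧ x ⁻¹' Z = x ⁻¹' X ∧
        cutW H wH Z ≤ cutW H wH X := by
    intro X h0
    rcases Set.eq_empty_or_nonempty (x ⁻¹' X) with he | hne
    · exact ⟨∅, fun _ _ _ h => h, by rw [he, Set.preimage_empty], by simp⟩
    · exact ⟨N (x ⁻¹' X), hσN _ hne h0, hN _, hNmin _ X rfl⟩
  refine ⟨σ, hreach, fun X => ?_, fun X u hu hX => ?_⟩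
  · by_cases h0 : ∀ i, x i ∈ X → i.1 ≠ 0
    · exact hlow X h0
    · push Not at h0
      obtain ⟨i, hi, hi0⟩ := h0
      obtain ⟨Z, hZ, hZx, hle⟩ := hlow Xᶜ fun j hj hj0 =>
        hj ((Fin.ext (hi0.trans hj0.symm) : i = j) ▸ hi)
      refine ⟨Zᶜ, fun u v huv hu hv => hu (hZ v u huv.symm hv), ?_, ?_⟩
      · rw [Set.preimage_compl, hZx, Set.preimage_compl, compl_compl]
      · rwa [cutW_compl, ← cutW_compl H wH X]
  · obtain ⟨h1, h2, h3⟩ := hM₀ u (X ∩ {v | H.Reachable u v})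
      ⟨u, hu, SimpleGraph.Reachable.refl u⟩ Set.inter_subset_right
      (Set.eq_empty_of_forall_notMem fun i hi => hX i hi.2 hi.1)
    exact ⟨M₀ ∩ {v | H.Reachable u v},
      fun a b hab ha => ⟨hσ₀ a b hab ha.1, SimpleGraph.Reachable.trans ha.2 (hreach a b hab)⟩,
      h2, h1, Set.inter_subset_right, h3.trans (cutW_inter_reachable_le H wH u X)⟩

variable {H wH x}

/-- Contracting interior vertices with equal signature preserves the connectivities of the
components of every boundary sum. -/
lemma connMultiset_bsum_contract {n : ℕ} (hwH : ∀ e ∈ H.edgeSet, 0 < wH e) (hx : ProperB H x)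
    {q : VH → Fin n} (hq : q.Surjective) {x' : Fin r ↪ Fin n} (hx' : ∀ i, x' i = q (x i))
    (hinner : ∀ v i, q v = q (x i) → v = x i)
    (hreach : ∀ u v, q u = q v → H.Reachable u v)
    (hmin : ∀ X : Set VH, ∃ Z : Set VH, (∀ u v, q u = q v → u ∈ Z → v ∈ Z) ∧
      x ⁻¹' Z = x ⁻¹' X ∧ cutW H wH Z ≤ cutW H wH X)
    (hmin₀ : ∀ (X : Set VH) (u : VH), u ∈ X → (∀ i, H.Reachable u (x i) → x i ∉ X) →
      ∃ Z : Set VH, (∀ u v, q u = q v → u ∈ Z → v ∈ Z) ∧ x ⁻¹' Z = ∅ ∧ Z.Nonempty ∧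
        Z ⊆ {v | H.Reachable u v} ∧ cutW H wH Z ≤ cutW H wH X)
    (hnadj : ∀ i j, ¬ (contractGraph q H).Adj (x' i) (x' j))
    {VF : Type*} [Fintype VF] {F : SimpleGraph VF} {wF : Sym2 VF → ℕ}
    (hwF : ∀ e ∈ F.edgeSet, 0 < wF e) (y : Fin r ↪ VF) :
    connMultiset (BSum F y H x) (BSumW wF wH y x) =
      connMultiset (BSum F y (contractGraph q H) x')
        (BSumW wF (contractWeight q H wH) y x') := by
  have hnr : ∀ v, v ∉ Set.range x → q v ∉ Set.range x' := by
    rintro v hv ⟨i, hi⟩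
    rw [hx'] at hi
    exact hv ⟨i, (hinner v i hi.symm).symm⟩
  let Q : VF ⊕ {v : VH // v ∉ Set.range x} → VF ⊕ {v : Fin n // v ∉ Set.range x'} :=
    Sum.map id fun v => ⟨q v.1, hnr v.1 v.2⟩
  have hQinr : ∀ v, bsumInr y x' (q v) = Q (bsumInr y x v) := by
    intro v
    by_cases hv : v ∈ Set.range x
    · obtain ⟨i, rfl⟩ := hv
      rw [← hx', bsumInr_boundary, bsumInr_boundary]
      rfl
    · rw [bsumInr_inner y x ⟨v, hv⟩]
      exact bsumInr_inner y x' ⟨q v, hnr v hv⟩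
  have hQ : Q.Surjective := by
    rintro (a | ⟨b, hb⟩)
    · exact ⟨.inl a, rfl⟩
    · obtain ⟨v, rfl⟩ := hq b
      refine ⟨.inr ⟨v, ?_⟩, rfl⟩
      rintro ⟨i, rfl⟩
      exact hb ⟨i, hx' i⟩
  have hcut : ∀ Y', cutW (BSum F y (contractGraph q H) x')
      (BSumW wF (contractWeight q H wH) y x') Y' =
        cutW (BSum F y H x) (BSumW wF wH y x) (Q ⁻¹' Y') := by
    intro Y'
    rw [cutW_bsum hnadj, cutW_bsum hx.1, cutW_contract]
    congr 2
    ext v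
    simp only [Set.mem_preimage, hQinr]
  have hbreach : ∀ u v, H.Reachable u v →
      (BSum F y H x).Reachable (bsumInr y x u) (bsumInr y x v) :=
    fun u v h => bsum_reachable_of_reachable hx.1 hwH h
  -- a saturated set of the second summand, together with a compatible set of the first one
  have hlift : ∀ (A : Set VF) (Z : Set VH), (∀ u v, q u = q v → u ∈ Z → v ∈ Z) →
      x ⁻¹' Z = y ⁻¹' A → ∃ Y' : Set (VF ⊕ {v : Fin n // v ∉ Set.range x'}),
        (∀ a, Q (.inl a) ∈ Y' ↔ a ∈ A) ∧ (∀ v, Q (bsumInr y x v) ∈ Y' ↔ v ∈ Z) ∧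
        cutW (BSum F y H x) (BSumW wF wH y x) (Q ⁻¹' Y') = cutW F wF A + cutW H wH Z := by
    intro A Z hZ hAZ
    let Y' : Set (VF ⊕ {v : Fin n // v ∉ Set.range x'}) :=
      {z | Sum.elim (· ∈ A) (fun b => ∃ v ∈ Z, q v = b.1) z}
    have h1 : ∀ a, Q (.inl a) ∈ Y' ↔ a ∈ A := fun a => Iff.rfl
    have h2 : ∀ v, Q (bsumInr y x v) ∈ Y' ↔ v ∈ Z := by
      intro v
      by_cases hv : v ∈ Set.range x
      · obtain ⟨i, rfl⟩ := hv
        rw [bsumInr_boundary, h1]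
        exact (Set.ext_iff.1 hAZ i).symm
      · rw [bsumInr_inner y x ⟨v, hv⟩]
        exact ⟨fun ⟨u, hu, huv⟩ => hZ u v huv hu, fun h => ⟨v, h, rfl⟩⟩
    refine ⟨Y', h1, h2, ?_⟩
    rw [cutW_bsum hx.1]
    congr 2
    exact Set.ext h2
  have hinl : ∀ z, ∃ a, (BSum F y H x).Reachable z (.inl a) := by
    rintro (a | b)
    · exact ⟨a, SimpleGraph.Reachable.refl _⟩
    · obtain ⟨i, hi⟩ := hx.2 b.1
      have h := hbreach _ _ hi
      rw [bsumInr_inner, bsumInr_boundary] at h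
      exact ⟨y i, h⟩
  -- a side of a cut of the component of `z` avoiding the first summand can be replaced by a
  -- saturated one
  have hside : ∀ (Y : Set (VF ⊕ {v : VH // v ∉ Set.range x})) z, z ∈ Y →
      (∀ a, (BSum F y H x).Reachable z (.inl a) → Sum.inl a ∉ Y) →
      ∃ (Y' : Set (VF ⊕ {v : Fin n // v ∉ Set.range x'})) (c d : _),
        (BSum F y H x).Reachable z c ∧ (BSum F y H x).Reachable z d ∧ Q c ∈ Y' ∧ Q d ∉ Y' ∧
        cutW (BSum F y H x) (BSumW wF wH y x) (Q ⁻¹' Y') ≤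
          cutW (BSum F y H x) (BSumW wF wH y x) Y := by
    intro Y z hz hY
    rcases z with a | u
    · exact absurd hz (hY a (SimpleGraph.Reachable.refl _))
    have huz := bsumInr_inner y x u
    obtain ⟨Z, hZ, hZx, ⟨v, hv⟩, hZu, hle⟩ := hmin₀ (bsumInr y x ⁻¹' Y) u.1
      (by rwa [Set.mem_preimage, huz]) (by
        intro i hi
        have h := hbreach _ _ hi
        rw [huz, bsumInr_boundary] at h
        rw [Set.mem_preimage, bsumInr_boundary]
        exact hY _ h)
    obtain ⟨Y', h1, h2, h3⟩ := hlift ∅ Z hZ (by rw [hZx, Set.preimage_empty])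
    obtain ⟨a, ha⟩ := hinl (.inr u)
    refine ⟨Y', bsumInr y x v, .inl a, ?_, ha, (h2 v).2 hv, fun h => (h1 a).1 h, ?_⟩
    · have h := hbreach _ _ (hZu hv)
      rwa [huz] at h
    · rw [h3, cutW_empty, zero_add, cutW_bsum hx.1]
      exact hle.trans (Nat.le_add_left _ _)
  refine connMultiset_eq_of_contraction (bsumW_pos hwF hwH)
    (bsumW_pos hwF (contractWeight_pos hwH)) hQ hcut ?_ ?_
  · rintro (a | a) (b | b) h
    · obtain rfl : a = b := Sum.inl.inj h
      exact SimpleGraph.Reachable.refl _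
    · cases h
    · cases h
    · have h1 := hbreach _ _ (hreach a.1 b.1 (congrArg Subtype.val (Sum.inr.inj h)))
      rwa [bsumInr_inner, bsumInr_inner] at h1
  · intro Y a b hab ha hb
    by_cases hin : ∃ c, (BSum F y H x).Reachable a (.inl c) ∧ Sum.inl c ∈ Y
    · by_cases hout : ∃ d, (BSum F y H x).Reachable a (.inl d) ∧ Sum.inl d ∉ Y
      · obtain ⟨c, hc, hcY⟩ := hin
        obtain ⟨d, hd, hdY⟩ := hout
        obtain ⟨Z, hZ, hZx, hle⟩ := hmin (bsumInr y x ⁻¹' Y)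
        obtain ⟨Y', h1, -, h3⟩ := hlift (Sum.inl ⁻¹' Y) Z hZ (by
          rw [hZx]
          ext i
          simp only [Set.mem_preimage, bsumInr_boundary])
        refine ⟨Y', .inl c, .inl d, hc, hd, (h1 c).2 hcY, fun h => hdY ((h1 d).1 h), ?_⟩
        rw [h3, cutW_bsum hx.1]
        exact Nat.add_le_add_left hle _
      · obtain ⟨Y', c, d, hc, hd, hcY, hdY, hle⟩ := hside Yᶜ b hb
          fun e he heY => hout ⟨e, hab.trans he, heY⟩
        rw [cutW_compl] at hle
        exact ⟨Y', c, d, hab.trans hc, hab.trans hd, hcY, hdY, hle⟩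
    · exact hside Y a ha fun e he heY => hin ⟨e, he, heY⟩

end Mimic

/-- Let `(H,x)` be a properly `r`-boundaried weighted graph and `p` a positive integer.
Then there is a properly `r`-boundaried weighted graph `(H',x')` with at most
`2^{2^{r-1}} + r` vertices such that for every `r`-boundaried weighted graph `(F,y)`,
every positive integer `t` and all positive integers `λ_1,…,λ_t ≤ p`:
`(F,y) ⊕_b (H,x)` has exactly `t` connected components with weighted connectivities
`λ_1,…,λ_t` respectively iff the same holds for `(F,y) ⊕_b (H',x')`. -/
theorem stmt_7 {r p : ℕ} (hp : 0 < p) {VH : Type*} [Fintype VH]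
    (H : SimpleGraph VH) (wH : Sym2 VH → ℕ) (hwH : ∀ e ∈ H.edgeSet, 0 < wH e)
    (x : Fin r ↪ VH) (hx : ProperB H x) :
    ∃ (n : ℕ) (H' : SimpleGraph (Fin n)) (w' : Sym2 (Fin n) → ℕ) (x' : Fin r ↪ Fin n),
      n ≤ 2 ^ 2 ^ (r - 1) + r ∧ ProperB H' x' ∧ (∀ e ∈ H'.edgeSet, 0 < w' e) ∧
      ∀ (VF : Type*) [Fintype VF] (F : SimpleGraph VF) (wF : Sym2 VF → ℕ),
        (∀ e ∈ F.edgeSet, 0 < wF e) → ∀ (y : Fin r ↪ VF) (t : ℕ), 0 < t →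
        ∀ lam : Fin t → ℕ, (∀ i, 0 < lam i ∧ lam i ≤ p) →
        (connMultiset (BSum F ⇑y H ⇑x) (BSumW wF wH ⇑y ⇑x) =
            (Finset.univ : Finset (Fin t)).val.map (fun i => (lam i : ℕ∞)) ↔
          connMultiset (BSum F ⇑y H' ⇑x') (BSumW wF w' ⇑y ⇑x') =
            (Finset.univ : Finset (Fin t)).val.map (fun i => (lam i : ℕ∞))) := by
  obtain ⟨σ, hreach, hmin, hmin₀⟩ := exists_cut_signature H wH x hwH hx
  let q₀ : VH → Fin r ⊕ Set (Set (Fin (r - 1))) := fun v =>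
    if h : v ∈ Set.range x then Sum.inl h.choose else Sum.inr (σ v)
  have hq₀ : ∀ i, q₀ (x i) = Sum.inl i := by
    intro i
    have h : x i ∈ Set.range x := ⟨i, rfl⟩
    simp only [q₀, dif_pos h]
    rw [x.injective h.choose_spec]
  have hq₀' : ∀ v, v ∉ Set.range x → q₀ v = Sum.inr (σ v) := fun v hv => dif_neg hv
  have hinner₀ : ∀ v i, q₀ v = q₀ (x i) → v = x i := by
    intro v i h
    by_cases hv : v ∈ Set.range x
    · obtain ⟨j, rfl⟩ := hv
      rw [hq₀, hq₀] at h
      rw [Sum.inl.inj h]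
    · rw [hq₀, hq₀' v hv] at h
      cases h
  have heq : ∀ u v, q₀ u = q₀ v → σ u = σ v := by
    intro u v h
    by_cases hv : v ∈ Set.range x
    · obtain ⟨j, rfl⟩ := hv
      rw [hinner₀ u j h]
    by_cases hu : u ∈ Set.range x
    · obtain ⟨j, rfl⟩ := hu
      rw [hinner₀ v j h.symm]
    rw [hq₀' u hu, hq₀' v hv] at h
    exact Sum.inr.inj h
  let e : Set.range q₀ ≃ Fin (Fintype.card (Set.range q₀)) := Fintype.equivFin _
  let q : VH → Fin (Fintype.card (Set.range q₀)) := fun v => e ⟨q₀ v, v, rfl⟩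
  have hqq₀ : ∀ u v, q u = q v → q₀ u = q₀ v := fun u v h =>
    congrArg Subtype.val (e.injective h)
  have hq : q.Surjective := by
    intro b
    obtain ⟨⟨_, v, rfl⟩, rfl⟩ := e.surjective b
    exact ⟨v, rfl⟩
  have hinner : ∀ v i, q v = q (x i) → v = x i := fun v i h => hinner₀ v i (hqq₀ _ _ h)
  have hσ : ∀ u v, q u = q v → σ u = σ v := fun u v h => heq u v (hqq₀ u v h)
  let x' : Fin r ↪ Fin (Fintype.card (Set.range q₀)) :=
    ⟨fun i => q (x i), fun i j h => x.injective (hinner _ _ h)⟩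
  have hnadj : ∀ i j, ¬ (contractGraph q H).Adj (x' i) (x' j) := by
    rintro i j ⟨-, u, v, hu, hv, huv⟩
    rw [hinner u i hu, hinner v j hv] at huv
    exact hx.1 i j huv
  refine ⟨_, contractGraph q H, contractWeight q H wH, x', ?_, ⟨hnadj, ?_⟩,
    contractWeight_pos hwH, ?_⟩
  · refine (Fintype.card_subtype_le _).trans ?_
    rw [Fintype.card_sum, Fintype.card_set, Fintype.card_set, Fintype.card_fin,
      Fintype.card_fin, add_comm]
  · intro b
    obtain ⟨v, rfl⟩ := hq b
    obtain ⟨i, hi⟩ := hx.2 v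
    exact ⟨i, contract_reachable hi⟩
  · intro VF _ F wF hwF y t _ lam _
    rw [connMultiset_bsum_contract hwH hx hq (fun _ => rfl) hinner
      (fun u v h => hreach u v (hσ u v h))
      (fun X => (hmin X).imp fun Z hZ => ⟨fun u v h => hZ.1 u v (hσ u v h), hZ.2⟩)
      (fun X u hu hX => (hmin₀ X u hu hX).imp fun Z hZ =>
        ⟨fun u v h => hZ.1 u v (hσ u v h), hZ.2⟩)
      hnadj hwF y]
end

section
/- Let k be a positive integer and let G be a weighted graph with s connected components, each of weighted connectivity at most k. For i ∈ {1,…,k}, let H_i be the union of the connected components of G of weighted connectivity exactly i and let s_i be the number of these components. Let Λ = ⟨λ_1,…,λ_t⟩ be a nondecreasing tuple with entries in ℕ∪{+∞}. Then (G,w,Λ,k) is a yes-instance of CGWC if and only if there exist nonnegative integers h_1,…,h_k, p_1,…,p_k, t_1,…,t_k and subtuples Λ^i ⊆ Λ of length t_i (for i ∈ {1,…,k}) such that: (i) h_1+⋯+h_k ≤ k; (ii) p_i ≤ s_i and p_i ≤ t_i ≤ 2h_i for every i; (iii) Σ_{i=1}^k (t_i − p_i) = t − s; (iv) for each i ∈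 {1,…,k}, (H_i, w, (s_i−p_i)⟨i⟩ + Λ^i, h_i) is a yes-instance of CGWC; and (v) Λ ⪯ Σ_{i=1}^k ((s_i−p_i)⟨i⟩ + Λ^i). -/
open scoped Classical

/-- `α ⪯ β` for multisets viewed as nondecreasing tuples: the tuples have the same length
and the `i`-th smallest entry of `α` is at most the `i`-th smallest entry of `β`. -/
def DomLE (α β : Multiset ℕ∞) : Prop :=
  List.Forall₂ (· ≤ ·) (α.sort (· ≤ ·)) (β.sort (· ≤ ·))

/-- `(G,w,Λ,k)` is a yes-instance of CGWC: there is `F ⊆ E(G)` with `w(F) ≤ k` such that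
`G - F` has exactly `Λ.card` connected components `G_1,…,G_t` with `λ(G_i) ≥ λ_i`
(where `Λ = ⟨λ_1 ≤ … ≤ λ_t⟩`). -/
def IsYes {V : Type*} [Fintype V] (G : SimpleGraph V) (w : Sym2 V → ℕ)
    (Λ : Multiset ℕ∞) (k : ℕ) : Prop :=
  ∃ F : Finset (Sym2 V), ↑F ⊆ G.edgeSet ∧ (∑ e ∈ F, w e) ≤ k ∧
    DomLE Λ (connMultiset (G.deleteEdges ↑F) w)

/-- The set of vertices of `G` lying in connected components of weighted connectivity
exactly `i` (the vertex set of `H_i`). -/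
def lvlSet {V : Type*} [Fintype V] (G : SimpleGraph V) (w : Sym2 V → ℕ) (i : ℕ) :
    Set V :=
  {v : V | compConn G w (G.connectedComponentMk v).supp = (i : ℕ∞)}

/-- The number `s_i` of connected components of `G` of weighted connectivity exactly
`i`. -/
noncomputable def lvlCount {V : Type*} [Fintype V] (G : SimpleGraph V) (w : Sym2 V → ℕ)
    (i : ℕ) : ℕ :=
  Nat.card {c : G.ConnectedComponent // compConn G w c.supp = (i : ℕ∞)}

theorem forall₂_orderedInsert {α : Type*} [LinearOrder α] {a b : α} (hab : a ≤ b)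
    {l₁ l₂ : List α} (h : List.Forall₂ (· ≤ ·) l₁ l₂)
    (h₁ : l₁.Pairwise (· ≤ ·)) (h₂ : l₂.Pairwise (· ≤ ·)) :
    List.Forall₂ (· ≤ ·) (l₁.orderedInsert (· ≤ ·) a) (l₂.orderedInsert (· ≤ ·) b) := by
  induction h generalizing a b with
  | nil => simpa using hab
  | @cons x y l₁ l₂ hxy h ih =>
    have hx := (List.pairwise_cons.1 h₁)
    have hy := (List.pairwise_cons.1 h₂)
    have ex : l₁.orderedInsert (· ≤ ·) x = x :: l₁ := by
      cases l₁ with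
      | nil => rfl
      | cons z l => rw [List.orderedInsert_cons_of_le _ _ (hx.1 z (by simp))]
    have ey : l₂.orderedInsert (· ≤ ·) y = y :: l₂ := by
      cases l₂ with
      | nil => rfl
      | cons z l => rw [List.orderedInsert_cons_of_le _ _ (hy.1 z (by simp))]
    rw [List.orderedInsert_cons, List.orderedInsert_cons]
    split_ifs with hax hby hby
    · exact .cons hab (.cons hxy h)
    · refine .cons (hax.trans hxy) ?_
      rw [← ex]
      exact ih (hxy.trans (not_le.1 hby).le) hx.2 hy.2
    · refine .cons ((not_le.1 hax).le.trans hab) ?_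
      rw [← ey]
      exact ih (hab.trans hby) hx.2 hy.2
    · exact .cons hxy (ih hab hx.2 hy.2)

theorem forall₂_insertionSort {α : Type*} [LinearOrder α] {l₁ l₂ : List α}
    (h : List.Forall₂ (· ≤ ·) l₁ l₂) :
    List.Forall₂ (· ≤ ·) (l₁.insertionSort (· ≤ ·)) (l₂.insertionSort (· ≤ ·)) := by
  induction h with
  | nil => exact .nil
  | cons hab _ ih =>
    exact forall₂_orderedInsert hab ih (List.pairwise_insertionSort _ _)
      (List.pairwise_insertionSort _ _)

theorem multiset_rel_coe_iff {α β : Type*} {r : α → β → Prop} {s : Multiset α}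
    {t : Multiset β} :
    Multiset.Rel r s t ↔ ∃ (l₁ : List α) (l₂ : List β), (l₁ : Multiset α) = s ∧ (l₂ : Multiset β) = t ∧
      List.Forall₂ r l₁ l₂ := by
  constructor
  · intro h
    induction h with
    | zero => exact ⟨[], [], rfl, rfl, .nil⟩
    | cons hab _ ih =>
      obtain ⟨l₁, l₂, rfl, rfl, h⟩ := ih
      exact ⟨_ :: l₁, _ :: l₂, rfl, rfl, .cons hab h⟩
  · rintro ⟨l₁, l₂, rfl, rfl, h⟩
    induction h with
    | nil => exact .zero
    | cons hab _ ih => exact .cons hab ih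

theorem domLE_iff_rel {α β : Multiset ℕ∞} : DomLE α β ↔ Multiset.Rel (· ≤ ·) α β := by
  constructor
  · intro h
    exact multiset_rel_coe_iff.2 ⟨_, _, Multiset.sort_eq _ _, Multiset.sort_eq _ _, h⟩
  · intro h
    obtain ⟨l₁, l₂, rfl, rfl, hl⟩ := multiset_rel_coe_iff.1 h
    have key : ∀ l : List ℕ∞, (l : Multiset ℕ∞).sort (· ≤ ·) = l.insertionSort (· ≤ ·) := by
      intro l
      refine List.Perm.eq_of_pairwise' (Multiset.pairwise_sort _ _)
        (List.pairwise_insertionSort _ _) ?_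
      rw [← Multiset.coe_eq_coe, Multiset.sort_eq, Multiset.coe_eq_coe]
      exact (List.perm_insertionSort _ _).symm
    rw [DomLE, key, key]
    exact forall₂_insertionSort hl

theorem multiset_rel_sum {α β ι : Type*} {r : α → β → Prop} (s : Finset ι)
    {f : ι → Multiset α} {g : ι → Multiset β} (h : ∀ i ∈ s, Multiset.Rel r (f i) (g i)) :
    Multiset.Rel r (∑ i ∈ s, f i) (∑ i ∈ s, g i) := by
  induction s using Finset.induction_on with
  | empty => exact .zero
  | insert a s ha ih =>
    rw [Finset.sum_insert ha, Finset.sum_insert ha]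
    exact (h a (by simp)).add (ih fun i hi => h i (by simp [hi]))

theorem exists_of_multiset_rel_sum {α β ι : Type*} {r : α → β → Prop} (s : Finset ι)
    {a : Multiset α} {g : ι → Multiset β} (h : Multiset.Rel r a (∑ i ∈ s, g i)) :
    ∃ f : ι → Multiset α, a = ∑ i ∈ s, f i ∧ ∀ i ∈ s, Multiset.Rel r (f i) (g i) := by
  induction s using Finset.induction_on generalizing a with
  | empty => exact ⟨fun _ => 0, by simpa using h, by simp⟩
  | insert x s hx ih =>
    rw [Finset.sum_insert hx, Multiset.rel_add_right] at h
    obtain ⟨b, c, hb, hc, rfl⟩ := h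
    obtain ⟨f, rfl, hf⟩ := ih hc
    have hne : ∀ i ∈ s, i ≠ x := fun i hi e => hx (e ▸ hi)
    refine ⟨Function.update f x b, ?_, ?_⟩
    · rw [Finset.sum_insert hx, Function.update_self]
      congr 1
      exact Finset.sum_congr rfl fun i hi => by rw [Function.update_of_ne (hne i hi)]
    · intro i hi
      rcases Finset.mem_insert.1 hi with rfl | hi
      · simpa using hb
      · rw [Function.update_of_ne (hne i hi)]
        exact hf i hi

theorem weightConn_le_of_iso {V V' : Type*} [Fintype V] [Fintype V'] {G : SimpleGraph V}
    {G' : SimpleGraph V'} (e : G ≃g G') {w : Sym2 V → ℕ} {w' : Sym2 V' → ℕ}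
    (h : ∀ x, w' (Sym2.map e x) = w x) : weightConn G w ≤ weightConn G' w' := by
  refine sSup_le_sSup fun k hk S' hS' hsum => ?_
  have hinj : Function.Injective (Sym2.map e) := Sym2.map.injective e.injective
  have himg : (Finset.univ.filter fun x => Sym2.map e x ∈ S').image (Sym2.map e) = S' := by
    ext y
    simp only [Finset.mem_image, Finset.mem_filter, Finset.mem_univ, true_and]
    constructor
    · rintro ⟨x, hx, rfl⟩
      exact hx
    · intro hy
      have hxy : Sym2.map e (Sym2.map e.symm y) = y := by
        rw [Sym2.map_map, show ⇑e ∘ ⇑e.symm = id from funext e.apply_symm_apply, Sym2.map_id, id]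
      exact ⟨Sym2.map e.symm y, by rwa [hxy], hxy⟩
  have hconn := hk (Finset.univ.filter fun x => Sym2.map e x ∈ S') ?_ ?_
  · let e' : G.deleteEdges ↑(Finset.univ.filter fun x => Sym2.map e x ∈ S') ≃g
        G'.deleteEdges ↑S' :=
      { toEquiv := e.toEquiv
        map_rel_iff' := by
          intro a b
          have := e.map_adj_iff (v := a) (w := b)
          simpa [SimpleGraph.deleteEdges_adj] using fun _ => this }
    exact e'.connected_iff.1 hconn
  · intro x hx
    have hx' : Sym2.map e x ∈ S' := by simpa using hx
    have := hS' hx'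
    induction x with
    | _ a b => exact e.map_adj_iff.1 (by simpa using this)
  · rw [← himg, Finset.sum_image fun a _ b _ hab => hinj hab] at hsum
    simpa [h] using hsum

theorem weightConn_congr {V V' : Type*} [Fintype V] [Fintype V'] {G : SimpleGraph V}
    {G' : SimpleGraph V'} (e : G ≃g G') {w : Sym2 V → ℕ} {w' : Sym2 V' → ℕ}
    (h : ∀ x, w' (Sym2.map e x) = w x) : weightConn G w = weightConn G' w' := by
  refine le_antisymm (weightConn_le_of_iso e h) (weightConn_le_of_iso e.symm fun x => ?_)
  rw [← h, Sym2.map_map, show ⇑e ∘ ⇑e.symm = id from funext e.apply_symm_apply, Sym2.map_id, id]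

theorem compConn_induce {V : Type*} [Fintype V] (G : SimpleGraph V) (w : Sym2 V → ℕ)
    (S : Set V) (C : Set S) :
    compConn (G.induce S) (fun e => w (Sym2.map Subtype.val e)) C =
      compConn G w (Subtype.val '' C) := by
  let e : (G.induce S).induce C ≃g G.induce (Subtype.val '' C) :=
    { toEquiv := Equiv.Set.image Subtype.val C Subtype.val_injective
      map_rel_iff' := by intro a b; rfl }
  refine weightConn_congr e fun x => ?_
  simp only [Sym2.map_map]
  rfl

theorem one_le_compConn {V : Type*} [Fintype V] (G : SimpleGraph V) (w : Sym2 V → ℕ)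
    (hw : ∀ e ∈ G.edgeSet, 0 < w e) (c : G.ConnectedComponent) :
    1 ≤ compConn G w c.supp := by
  refine le_sSup fun S hS hsum => ?_
  have hS0 : S = ∅ := by
    rw [Finset.eq_empty_iff_forall_notMem]
    intro x hx
    have h0 := (Finset.sum_eq_zero_iff.1 (Order.lt_one_iff.1 hsum)) x hx
    have hmem := hS hx
    have hpos : 0 < w (Sym2.map Subtype.val x) := by
      apply hw
      induction x with
      | _ a b => simpa using hmem
    simp at h0
    omega
  subst hS0
  rw [Finset.coe_empty, SimpleGraph.deleteEdges_empty]
  exact c.connected_toSimpleGraph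

theorem connMultiset_eq_sum {V : Type*} [Fintype V] (G : SimpleGraph V) (w : Sym2 V → ℕ)
    [Fintype G.ConnectedComponent] :
    connMultiset G w = ∑ c : G.ConnectedComponent, {compConn G w c.supp} := by
  rw [connMultiset, ← Multiset.sum_map_singleton (Multiset.map _ _), Multiset.map_map]
  rw [Finset.sum]
  congr!

theorem adj_closed_reachable {V : Type*} {G : SimpleGraph V} {S : Set V}
    (hS : ∀ u v, G.Adj u v → u ∈ S → v ∈ S) {u v : V} (h : G.Reachable u v) (hu : u ∈ S) :
    ∃ hv : v ∈ S, (G.induce S).Reachable ⟨u, hu⟩ ⟨v, hv⟩ := by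
  obtain ⟨p⟩ := h
  induction p with
  | nil => exact ⟨hu, .refl _⟩
  | @cons a b _ hab _ ih =>
    obtain ⟨hv, h⟩ := ih (hS _ _ hab hu)
    refine ⟨hv, .trans (SimpleGraph.Adj.reachable ?_) h⟩
    exact hab

theorem connMultiset_induce {V : Type*} [Fintype V] (G : SimpleGraph V) (w : Sym2 V → ℕ)
    [Fintype G.ConnectedComponent] (S : Set V) (hS : ∀ u v, G.Adj u v → u ∈ S → v ∈ S) :
    connMultiset (G.induce S) (fun e => w (Sym2.map Subtype.val e)) =
      ∑ c : G.ConnectedComponent with c.supp ⊆ S, {compConn G w c.supp} := by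
  have : Fintype (G.induce S).ConnectedComponent := Fintype.ofFinite _
  have hsupp : ∀ c : (G.induce S).ConnectedComponent,
      (c.map (SimpleGraph.Embedding.induce S).toHom).supp = Subtype.val '' c.supp := by
    intro c
    induction c using SimpleGraph.ConnectedComponent.ind with
    | _ u =>
      ext v
      simp only [SimpleGraph.ConnectedComponent.map_mk, SimpleGraph.ConnectedComponent.mem_supp_iff,
        SimpleGraph.ConnectedComponent.eq, Set.mem_image]
      constructor
      · intro h
        obtain ⟨hv, h'⟩ := adj_closed_reachable hS h.symm u.2
        exact ⟨⟨v, hv⟩, h'.symm, rfl⟩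
      · rintro ⟨v, h, rfl⟩
        exact h.map (SimpleGraph.Embedding.induce S).toHom
  rw [connMultiset_eq_sum]
  refine Finset.sum_bij (fun c _ => c.map (SimpleGraph.Embedding.induce S).toHom) ?_ ?_ ?_ ?_
  · intro c _
    rw [Finset.mem_filter, hsupp]
    refine ⟨Finset.mem_univ _, ?_⟩
    rintro _ ⟨v, _, rfl⟩
    exact v.2
  · intro c _ d _ h
    have h := congrArg SimpleGraph.ConnectedComponent.supp h
    rw [hsupp, hsupp] at h
    exact SimpleGraph.ConnectedComponent.supp_injective
      (Subtype.val_injective.image_injective h)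
  · intro c hc
    rw [Finset.mem_filter] at hc
    induction c using SimpleGraph.ConnectedComponent.ind with
    | _ u => exact ⟨(G.induce S).connectedComponentMk ⟨u, hc.2 rfl⟩, Finset.mem_univ _, rfl⟩
  · intro c _
    rw [hsupp, compConn_induce]

/-- Deleting `F` from a graph all of whose components have weighted connectivity `i` keeps the
components that avoid `F`, and the remaining pieces are bounded in terms of `w(F)`. -/
theorem connMultiset_deleteEdges {V : Type*} [Fintype V] (H : SimpleGraph V) (w : Sym2 V → ℕ)
    (hw : ∀ e ∈ H.edgeSet, 0 < w e) (i : ℕ∞)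
    (hi : ∀ c : H.ConnectedComponent, compConn H w c.supp = i)
    (F : Finset (Sym2 V)) (hF : ↑F ⊆ H.edgeSet) :
    ∃ (p : ℕ) (M : Multiset ℕ∞), p ≤ Nat.card H.ConnectedComponent ∧ p ≤ M.card ∧
      M.card ≤ 2 * ∑ e ∈ F, w e ∧
      connMultiset (H.deleteEdges ↑F) w =
        Multiset.replicate (Nat.card H.ConnectedComponent - p) i + M := by
  have : Fintype H.ConnectedComponent := Fintype.ofFinite _
  have : Fintype (H.deleteEdges ↑F).ConnectedComponent := Fintype.ofFinite _
  let U : Finset V := F.biUnion Sym2.toFinset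
  have hU : ∀ v, v ∈ U ↔ ∃ e ∈ F, v ∈ e := by simp [U]
  let P : (H.deleteEdges ↑F).ConnectedComponent → Prop := fun c => ∃ v ∈ U, v ∈ c.supp
  let Q : H.ConnectedComponent → Prop := fun c => ∃ v ∈ U, v ∈ c.supp
  let π : (H.deleteEdges ↑F).ConnectedComponent → H.ConnectedComponent :=
    fun c => c.map (SimpleGraph.Hom.ofLE (SimpleGraph.deleteEdges_le _))
  have hπmk : ∀ v, π ((H.deleteEdges ↑F).connectedComponentMk v) = H.connectedComponentMk v :=
    fun _ => rfl
  have hπsub : ∀ c, c.supp ⊆ (π c).supp := by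
    intro c v hv
    rw [SimpleGraph.ConnectedComponent.mem_supp_iff] at hv ⊢
    rw [← hv, hπmk]
  have hπeq : ∀ c, ¬ P c → (π c).supp = c.supp := by
    intro c hc
    refine Set.Subset.antisymm ?_ (hπsub c)
    induction c using SimpleGraph.ConnectedComponent.ind with
    | _ u =>
      intro v hv
      have hr : H.Reachable u v := (SimpleGraph.ConnectedComponent.eq.1 hv).symm
      refine (adj_closed_reachable
        (S := ((H.deleteEdges ↑F).connectedComponentMk u).supp) ?_ hr rfl).1
      intro a b hab ha
      have : (H.deleteEdges ↑F).Adj a b := by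
        rw [SimpleGraph.deleteEdges_adj]
        exact ⟨hab, fun h => hc ⟨a, (hU a).2 ⟨_, h, by simp⟩, ha⟩⟩
      exact (SimpleGraph.ConnectedComponent.mem_supp_congr_adj _ this).1 ha
  have hπP : ∀ c, P c → Q (π c) := fun c ⟨v, hv, hvc⟩ => ⟨v, hv, hπsub c hvc⟩
  have hπQ : ∀ c, ¬ P c → ¬ Q (π c) := by
    rintro c hc ⟨v, hv, hvc⟩
    rw [hπeq c hc] at hvc
    exact hc ⟨v, hv, hvc⟩
  have hsplit := Finset.card_filter_add_card_filter_not (s := Finset.univ) Q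
  rw [Finset.card_univ, ← Nat.card_eq_fintype_card] at hsplit
  have hcard : ∀ s : Finset (H.deleteEdges ↑F).ConnectedComponent,
      (∑ c ∈ s, ({compConn (H.deleteEdges ↑F) w c.supp} : Multiset ℕ∞)).card = s.card := by
    intro s
    simp
  refine ⟨(Finset.univ.filter Q).card,
    ∑ c with P c, {compConn (H.deleteEdges ↑F) w c.supp}, by omega, ?_, ?_, ?_⟩
  · rw [hcard]
    refine Finset.card_le_card_of_surjOn π ?_
    intro d hd
    simp only [Finset.coe_filter, Finset.mem_univ, true_and, Set.mem_ofPred_eq] at hd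
    obtain ⟨v, hv, rfl⟩ := hd
    exact ⟨(H.deleteEdges ↑F).connectedComponentMk v, by simpa using ⟨v, hv, rfl⟩, rfl⟩
  · rw [hcard]
    calc _ ≤ U.card := by
          refine Finset.card_le_card_of_surjOn (H.deleteEdges ↑F).connectedComponentMk ?_
          intro d hd
          simp only [Finset.coe_filter, Finset.mem_univ, true_and, Set.mem_ofPred_eq] at hd
          obtain ⟨v, hv, rfl⟩ := hd
          exact ⟨v, hv, rfl⟩
      _ ≤ F.card * 2 := Finset.card_biUnion_le_card_mul _ _ _ fun e _ => by
          rw [Sym2.card_toFinset]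
          split_ifs <;> omega
      _ ≤ 2 * ∑ e ∈ F, w e := by
          rw [mul_comm]
          refine Nat.mul_le_mul_left _ ?_
          rw [Finset.card_eq_sum_ones]
          exact Finset.sum_le_sum fun e he => hw e (hF he)
  · rw [connMultiset_eq_sum, ← Finset.sum_filter_not_add_sum_filter Finset.univ P]
    congr 1
    have hrep : Nat.card H.ConnectedComponent - (Finset.univ.filter Q).card =
        (Finset.univ.filter fun c => ¬ Q c).card := by omega
    rw [hrep, ← Multiset.nsmul_singleton, ← Finset.sum_const]
    refine Finset.sum_bij (fun c _ => π c) ?_ ?_ ?_ ?_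
    · intro c hc
      simpa using hπQ c (by simpa using hc)
    · intro c hc d hd h
      apply SimpleGraph.ConnectedComponent.supp_injective
      rw [← hπeq c (by simpa using hc), ← hπeq d (by simpa using hd), h]
    · intro d hd
      induction d using SimpleGraph.ConnectedComponent.ind with
      | _ v =>
        refine ⟨(H.deleteEdges ↑F).connectedComponentMk v, ?_, rfl⟩
        rw [Finset.mem_filter] at hd ⊢
        exact ⟨Finset.mem_univ _, fun h => hd.2 (hπP _ h)⟩
    · intro c hc
      have hc : ¬ P c := by simpa using hc
      rw [← hi (π c), hπeq c hc]
      have hind : (H.deleteEdges ↑F).induce c.supp = H.induce c.supp := by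
        ext a b
        simp only [SimpleGraph.comap_adj, SimpleGraph.deleteEdges_adj,
          Function.Embedding.subtype_apply, and_iff_left_iff_imp]
        intro _ h
        exact hc ⟨a, (hU a).2 ⟨_, h, by simp⟩, a.2⟩
      rw [compConn, compConn, hind]

theorem mem_lvlSet_of_adj {V : Type*} [Fintype V] (G : SimpleGraph V) (w : Sym2 V → ℕ) (i : ℕ)
    {u v : V} (h : G.Adj u v) (hu : u ∈ lvlSet G w i) : v ∈ lvlSet G w i := by
  rw [lvlSet, Set.mem_ofPred_eq] at hu ⊢
  rwa [← SimpleGraph.ConnectedComponent.eq.2 h.reachable]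

theorem eq_of_mem_lvlSet {V : Type*} [Fintype V] {G : SimpleGraph V} {w : Sym2 V → ℕ} {i j : ℕ}
    {v : V} (hi : v ∈ lvlSet G w i) (hj : v ∈ lvlSet G w j) : i = j := by
  rw [lvlSet, Set.mem_ofPred_eq] at hi hj
  exact_mod_cast hi.symm.trans hj

theorem connMultiset_induce_lvlSet {V : Type*} [Fintype V] (G : SimpleGraph V)
    (w : Sym2 V → ℕ) (i : ℕ) :
    connMultiset (G.induce (lvlSet G w i)) (fun e => w (Sym2.map Subtype.val e)) =
      Multiset.replicate (lvlCount G w i) (i : ℕ∞) := by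
  have : Fintype G.ConnectedComponent := Fintype.ofFinite _
  have hiff : ∀ c : G.ConnectedComponent,
      c.supp ⊆ lvlSet G w i ↔ compConn G w c.supp = (i : ℕ∞) := by
    intro c
    constructor
    · intro h
      induction c using SimpleGraph.ConnectedComponent.ind with
      | _ v => exact h rfl
    · intro h v hv
      rw [SimpleGraph.ConnectedComponent.mem_supp_iff] at hv
      rw [lvlSet, Set.mem_ofPred_eq, hv, h]
  rw [connMultiset_induce G w _ fun _ _ => mem_lvlSet_of_adj G w i]
  simp only [hiff]
  rw [lvlCount, Nat.card_eq_fintype_card, Fintype.card_subtype, ← Multiset.nsmul_singleton,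
    ← Finset.sum_const]
  exact Finset.sum_congr rfl fun c hc => by rw [(Finset.mem_filter.1 hc).2]

theorem card_connMultiset {V : Type*} [Fintype V] (G : SimpleGraph V) (w : Sym2 V → ℕ) :
    (connMultiset G w).card = Nat.card G.ConnectedComponent := by
  have : Fintype G.ConnectedComponent := Fintype.ofFinite _
  rw [connMultiset_eq_sum]
  simp

theorem card_connectedComponent_induce_lvlSet {V : Type*} [Fintype V] (G : SimpleGraph V)
    (w : Sym2 V → ℕ) (i : ℕ) :
    Nat.card (G.induce (lvlSet G w i)).ConnectedComponent = lvlCount G w i := by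
  rw [← card_connMultiset _ fun e => w (Sym2.map Subtype.val e), connMultiset_induce_lvlSet,
    Multiset.card_replicate]

theorem compConn_induce_lvlSet {V : Type*} [Fintype V] (G : SimpleGraph V)
    (w : Sym2 V → ℕ) (i : ℕ) (c : (G.induce (lvlSet G w i)).ConnectedComponent) :
    compConn (G.induce (lvlSet G w i)) (fun e => w (Sym2.map Subtype.val e)) c.supp = i := by
  refine Multiset.eq_of_mem_replicate (n := lvlCount G w i) ?_
  rw [← connMultiset_induce_lvlSet]
  exact Multiset.mem_map_of_mem _ (@Finset.mem_univ _ (Fintype.ofFinite _) c)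

theorem exists_mem_lvlSet {V : Type*} [Fintype V] (G : SimpleGraph V) (w : Sym2 V → ℕ)
    (hw : ∀ e ∈ G.edgeSet, 0 < w e) (k : ℕ)
    (hcomp : ∀ c : G.ConnectedComponent, compConn G w c.supp ≤ (k : ℕ∞)) (v : V) :
    ∃ i : Fin k, v ∈ lvlSet G w (i.1 + 1) := by
  have h₁ := one_le_compConn G w hw (G.connectedComponentMk v)
  have h₂ := hcomp (G.connectedComponentMk v)
  obtain ⟨n, hn⟩ := ENat.ne_top_iff_exists.1 (ne_top_of_le_ne_top (ENat.natCast_ne_top k) h₂)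
  rw [← hn] at h₁ h₂
  have h₁ : 1 ≤ n := by exact_mod_cast h₁
  have h₂ : n ≤ k := by exact_mod_cast h₂
  refine ⟨⟨n - 1, by omega⟩, ?_⟩
  rw [lvlSet, Set.mem_ofPred_eq, ← hn]
  congr 1
  simp only
  omega

/-- The edges of `F` inside the vertex set `S`. -/
noncomputable def edgesInside {V : Type*} [Fintype V] (S : Set V) (F : Finset (Sym2 V)) :
    Finset (Sym2 S) :=
  Finset.univ.filter fun e => Sym2.map Subtype.val e ∈ F

theorem mem_edgesInside {V : Type*} [Fintype V] {S : Set V} {F : Finset (Sym2 V)} {e : Sym2 S} :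
    e ∈ edgesInside S F ↔ Sym2.map Subtype.val e ∈ F := by
  simp [edgesInside]

theorem deleteEdges_edgesInside {V : Type*} [Fintype V] (G : SimpleGraph V) (S : Set V)
    (F : Finset (Sym2 V)) :
    (G.induce S).deleteEdges ↑(edgesInside S F) = (G.deleteEdges ↑F).induce S := by
  ext a b
  simp [SimpleGraph.deleteEdges_adj, mem_edgesInside]

theorem coe_edgesInside_subset {V : Type*} [Fintype V] {G : SimpleGraph V} (S : Set V)
    {F : Finset (Sym2 V)} (hF : ↑F ⊆ G.edgeSet) :
    ↑(edgesInside S F) ⊆ (G.induce S).edgeSet := by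
  intro e he
  have := hF (mem_edgesInside.1 he)
  induction e with
  | _ a b => simpa using this

theorem sum_edgesInside {V : Type*} [Fintype V] (S : Set V) (F : Finset (Sym2 V))
    (w : Sym2 V → ℕ) :
    ∑ e ∈ edgesInside S F, w (Sym2.map Subtype.val e) =
      ∑ e ∈ (edgesInside S F).image (Sym2.map Subtype.val), w e :=
  (Finset.sum_image fun _ _ _ _ h => Sym2.map.injective Subtype.val_injective h).symm

/-- If an edge lies inside both `S` and `T`, then `S` and `T` share a vertex. -/
theorem exists_mem_of_map_eq {V : Type*} {S T : Set V} {e : Sym2 S} {f : Sym2 T}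
    (h : Sym2.map Subtype.val e = Sym2.map Subtype.val f) : ∃ v, v ∈ S ∧ v ∈ T := by
  induction e with
  | _ a b =>
    have ha : (a : V) ∈ Sym2.map Subtype.val f := by rw [← h]; simp
    obtain ⟨c, _, hc⟩ := Sym2.mem_map.1 ha
    exact ⟨a, a.2, hc ▸ c.2⟩

theorem pairwiseDisjoint_image_lvlSet {V : Type*} [Fintype V] (G : SimpleGraph V)
    (w : Sym2 V → ℕ) (k : ℕ) (F : ∀ i : Fin k, Finset (Sym2 (lvlSet G w (i.1 + 1)))) :
    (↑(Finset.univ : Finset (Fin k)) : Set (Fin k)).PairwiseDisjoint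
      fun i => (F i).image (Sym2.map Subtype.val) := by
  intro i _ j _ hij
  rw [Function.onFun, Finset.disjoint_left]
  intro e he he'
  obtain ⟨e, _, rfl⟩ := Finset.mem_image.1 he
  obtain ⟨f, _, hf⟩ := Finset.mem_image.1 he'
  obtain ⟨v, hv, hv'⟩ := exists_mem_of_map_eq hf
  have := eq_of_mem_lvlSet hv hv'
  exact hij (Fin.ext (by omega))

theorem sum_edgesInside_lvlSet_le {V : Type*} [Fintype V] (G : SimpleGraph V) (w : Sym2 V → ℕ)
    (k : ℕ) (F : Finset (Sym2 V)) :
    ∑ i : Fin k, ∑ e ∈ edgesInside (lvlSet G w (i.1 + 1)) F, w (Sym2.map Subtype.val e) ≤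
      ∑ e ∈ F, w e := by
  simp only [sum_edgesInside]
  rw [← Finset.sum_biUnion]
  · refine Finset.sum_le_sum_of_subset fun e he => ?_
    simp only [Finset.mem_biUnion, Finset.mem_image] at he
    obtain ⟨i, _, e, he, rfl⟩ := he
    exact mem_edgesInside.1 he
  · exact pairwiseDisjoint_image_lvlSet G w k _

theorem connMultiset_eq_sum_lvlSet {V : Type*} [Fintype V] (G : SimpleGraph V) (w : Sym2 V → ℕ)
    (hw : ∀ e ∈ G.edgeSet, 0 < w e) (k : ℕ)
    (hcomp : ∀ c : G.ConnectedComponent, compConn G w c.supp ≤ (k : ℕ∞))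
    (F : Finset (Sym2 V)) :
    connMultiset (G.deleteEdges ↑F) w =
      ∑ i : Fin k, connMultiset ((G.induce (lvlSet G w (i.1 + 1))).deleteEdges
        ↑(edgesInside (lvlSet G w (i.1 + 1)) F)) (fun e => w (Sym2.map Subtype.val e)) := by
  have : Fintype (G.deleteEdges ↑F).ConnectedComponent := Fintype.ofFinite _
  have hadj : ∀ (i : ℕ) (u v : V), (G.deleteEdges ↑F).Adj u v → u ∈ lvlSet G w i →
      v ∈ lvlSet G w i :=
    fun i u v h => mem_lvlSet_of_adj G w i (SimpleGraph.deleteEdges_le _ h)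
  simp only [deleteEdges_edgesInside]
  rw [Finset.sum_congr rfl fun i _ => connMultiset_induce (G.deleteEdges ↑F) w _ (hadj (i.1 + 1)),
    connMultiset_eq_sum]
  simp only [Finset.sum_filter]
  rw [Finset.sum_comm]
  refine Finset.sum_congr rfl fun c _ => ?_
  induction c using SimpleGraph.ConnectedComponent.ind with
  | _ v =>
    obtain ⟨i, hi⟩ := exists_mem_lvlSet G w hw k hcomp v
    have hiff : ∀ j : Fin k, ((G.deleteEdges ↑F).connectedComponentMk v).supp ⊆
        lvlSet G w (j.1 + 1) ↔ i = j := by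
      intro j
      constructor
      · intro h
        have := eq_of_mem_lvlSet hi (h rfl)
        exact Fin.ext (by omega)
      · rintro rfl u hu
        exact (adj_closed_reachable (hadj _) (SimpleGraph.ConnectedComponent.eq.1 hu).symm hi).1
    simp [hiff]

theorem sum_lvlCount {V : Type*} [Fintype V] (G : SimpleGraph V) (w : Sym2 V → ℕ)
    (hw : ∀ e ∈ G.edgeSet, 0 < w e) (k : ℕ)
    (hcomp : ∀ c : G.ConnectedComponent, compConn G w c.supp ≤ (k : ℕ∞)) :
    ∑ i : Fin k, lvlCount G w (i.1 + 1) = Nat.card G.ConnectedComponent := by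
  have h := congrArg Multiset.card (connMultiset_eq_sum_lvlSet G w hw k hcomp ∅)
  have h0 : ∀ S : Set V, edgesInside S ∅ = ∅ := fun S => by simp [edgesInside]
  simp only [h0, Finset.coe_empty, SimpleGraph.deleteEdges_empty, connMultiset_induce_lvlSet,
    card_connMultiset, Multiset.card_sum, Multiset.card_replicate] at h
  exact h.symm

theorem edgesInside_biUnion_lvlSet {V : Type*} [Fintype V] (G : SimpleGraph V) (w : Sym2 V → ℕ)
    (k : ℕ) (F : ∀ i : Fin k, Finset (Sym2 (lvlSet G w (i.1 + 1)))) (i : Fin k) :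
    edgesInside (lvlSet G w (i.1 + 1))
      (Finset.univ.biUnion fun j => (F j).image (Sym2.map Subtype.val)) = F i := by
  ext e
  simp only [mem_edgesInside, Finset.mem_biUnion, Finset.mem_univ, true_and, Finset.mem_image]
  constructor
  · rintro ⟨j, f, hf, h⟩
    obtain ⟨v, hv, hv'⟩ := exists_mem_of_map_eq h
    obtain rfl : j = i := Fin.ext (by have := eq_of_mem_lvlSet hv hv'; omega)
    rwa [← Sym2.map.injective Subtype.val_injective h]
  · intro he
    exact ⟨i, e, he, rfl⟩

/-- Let `k` be a positive integer and `G` a weighted graph with `s` connected components,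
each of weighted connectivity at most `k`; for `i ∈ {1,…,k}` let `H_i` be the union of
the components of connectivity exactly `i` and `s_i` their number. Then `(G,w,Λ,k)` is a
yes-instance of CGWC iff there are nonnegative integers `h_i, p_i, t_i` and subtuples
`Λ^i ⊆ Λ` of length `t_i` (for `i ∈ {1,…,k}`, encoded below by `i = j+1` for `j : Fin k`)
such that (i) `h_1 + ⋯ + h_k ≤ k`; (ii) `p_i ≤ s_i` and `p_i ≤ t_i ≤ 2h_i`;
(iii) `Σ (t_i − p_i) = t − s`; (iv) `(H_i, w, (s_i−p_i)⟨i⟩ + Λ^i, h_i)` is a yes-instance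
of CGWC for each `i`; and (v) `Λ ⪯ Σ_i ((s_i−p_i)⟨i⟩ + Λ^i)`. -/
theorem stmt_19 {V : Type*} [Fintype V] (G : SimpleGraph V) (w : Sym2 V → ℕ)
    (hw : ∀ e ∈ G.edgeSet, 0 < w e) (k : ℕ) (hk : 0 < k)
    (hcomp : ∀ c : G.ConnectedComponent, compConn G w c.supp ≤ (k : ℕ∞))
    (Λ : Multiset ℕ∞) :
    IsYes G w Λ k ↔
      ∃ h p t : Fin k → ℕ, ∃ Λs : Fin k → Multiset ℕ∞,
        (∑ i, h i) ≤ k ∧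
        (∀ i : Fin k, p i ≤ lvlCount G w (i.1 + 1) ∧ p i ≤ t i ∧ t i ≤ 2 * h i) ∧
        ((∑ i, t i) + Nat.card G.ConnectedComponent = Multiset.card Λ + ∑ i, p i) ∧
        (∀ i : Fin k, (Λs i).card = t i ∧ Λs i ≤ Λ ∧
          IsYes (G.induce (lvlSet G w (i.1 + 1))) (fun e => w (Sym2.map Subtype.val e))
            (Multiset.replicate (lvlCount G w (i.1 + 1) - p i) ((i.1 + 1 : ℕ) : ℕ∞) +
              Λs i) (h i)) ∧
        DomLE Λ
          (∑ i : Fin k,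
            (Multiset.replicate (lvlCount G w (i.1 + 1) - p i) ((i.1 + 1 : ℕ) : ℕ∞) +
              Λs i)) := by
  constructor
  · rintro ⟨F, hF, hFw, hdom⟩
    rw [domLE_iff_rel, connMultiset_eq_sum_lvlSet G w hw k hcomp] at hdom
    have hloc := fun i : Fin k => connMultiset_deleteEdges
      (G.induce (lvlSet G w (i.1 + 1))) (fun e => w (Sym2.map Subtype.val e))
      (fun e he => hw _ (by
        induction e with
        | _ a b => simpa using he))
      _ (compConn_induce_lvlSet G w (i.1 + 1)) (edgesInside _ F) (coe_edgesInside_subset _ hF)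
    simp only [card_connectedComponent_induce_lvlSet] at hloc
    choose p M hps hpM hMw hM using hloc
    obtain ⟨A, rfl, hA⟩ := exists_of_multiset_rel_sum _ hdom
    have hsplit : ∀ i, ∃ B C, Multiset.Rel (· ≤ ·) B
        (Multiset.replicate (lvlCount G w (i.1 + 1) - p i) ((i.1 + 1 : ℕ) : ℕ∞)) ∧
        Multiset.Rel (· ≤ ·) C (M i) ∧ A i = B + C := by
      intro i
      have := hA i (Finset.mem_univ i)
      rwa [hM, Multiset.rel_add_right] at this
    choose B C hB hC hAi using hsplit
    have hCM := fun i => Multiset.card_eq_card_of_rel (hC i)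
    have hrefl : ∀ s : Multiset ℕ∞, Multiset.Rel (· ≤ ·) s s :=
      fun s => Multiset.rel_refl_of_refl_on fun _ _ => le_rfl
    have hAR : ∀ i, Multiset.Rel (· ≤ ·) (A i) (Multiset.replicate
        (lvlCount G w (i.1 + 1) - p i) ((i.1 + 1 : ℕ) : ℕ∞) + C i) := by
      intro i
      rw [hAi]
      exact (hB i).add (hrefl _)
    have hdomR := multiset_rel_sum Finset.univ fun i _ => hAR i
    refine ⟨fun i => ∑ e ∈ edgesInside (lvlSet G w (i.1 + 1)) F, w (Sym2.map Subtype.val e),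
      p, fun i => (M i).card, C, (sum_edgesInside_lvlSet_le G w k F).trans hFw,
      fun i => ⟨hps i, hpM i, hMw i⟩, ?_, fun i => ⟨hCM i, ?_, ?_⟩, domLE_iff_rel.2 hdomR⟩
    · rw [Multiset.card_eq_card_of_rel hdomR, Multiset.card_sum, ← sum_lvlCount G w hw k hcomp,
        ← Finset.sum_add_distrib, ← Finset.sum_add_distrib]
      refine Finset.sum_congr rfl fun i _ => ?_
      rw [Multiset.card_add, Multiset.card_replicate, hCM]
      have := hps i
      omega
    · calc C i ≤ A i := by rw [hAi]; exact Multiset.le_add_left _ _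
        _ ≤ _ := Finset.single_le_sum (fun _ _ => Multiset.zero_le _) (Finset.mem_univ i)
    · refine ⟨_, coe_edgesInside_subset _ hF, le_rfl, ?_⟩
      rw [domLE_iff_rel, hM]
      exact (hrefl _).add (hC i)
  · rintro ⟨h, p, t, Λs, hh, -, -, hyes, hdom⟩
    choose F hF hFw hFd using fun i => (hyes i).2.2
    refine ⟨Finset.univ.biUnion fun j => (F j).image (Sym2.map Subtype.val), ?_, ?_, ?_⟩
    · intro e he
      simp only [Finset.mem_coe, Finset.mem_biUnion, Finset.mem_univ, true_and,
        Finset.mem_image] at he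
      obtain ⟨i, e, he, rfl⟩ := he
      have := hF i he
      induction e with
      | _ a b => simpa using this
    · calc _ = ∑ i : Fin k, ∑ e ∈ (F i).image (Sym2.map Subtype.val), w e :=
            Finset.sum_biUnion (pairwiseDisjoint_image_lvlSet G w k F)
        _ = ∑ i : Fin k, ∑ e ∈ F i, w (Sym2.map Subtype.val e) :=
            Finset.sum_congr rfl fun i _ => Finset.sum_image fun _ _ _ _ h =>
              Sym2.map.injective Subtype.val_injective h
        _ ≤ ∑ i, h i := Finset.sum_le_sum fun i _ => hFw i
        _ ≤ k := hh
    · rw [domLE_iff_rel] at hdom ⊢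
      refine hdom.trans (· ≤ ·) ?_
      rw [connMultiset_eq_sum_lvlSet G w hw k hcomp]
      simp only [edgesInside_biUnion_lvlSet]
      exact multiset_rel_sum _ fun i _ => domLE_iff_rel.1 (hFd i)
end
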